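/- arXiv:2409.20495 — 3 statements merged into one kernel-verified Lean document; each statement's English description precedes it below -/
import Mathlib

section
/- Let n ≥ 1, let k and ℓ be nonnegative integers with k, ℓ ≤ n, let σ be a partition of n−k, let τ be a partition of n−ℓ, and let Y be a (σ,(k))-transitive subset of the hyperoctahedral group C_2 ≀ S_n (the symmetry group of the n-dimensional cube). If k ≤ ℓ and σ∪(k) ⊴ τ∪(ℓ), then Y is also (τ,(ℓ))-transitive. -/
/-- The monoid hom `Perm (Fin n) →* MulAut (Fin n → G)`, permuting coordinates. -/
def permMulAut (G : Type*) [CommGroup G] (n : ℕ) :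
    Equiv.Perm (Fin n) →* MulAut (Fin n → G) where
  toFun π := MulEquiv.arrowCongr π (MulEquiv.refl G)
  map_one' := by ext f a; rfl
  map_mul' := by intro π σ; ext f a; rfl

/-- The wreath product `G ≀ Sₙ`. -/
abbrev Wr (G : Type*) [CommGroup G] (n : ℕ) :=
  SemidirectProduct (Fin n → G) (Equiv.Perm (Fin n)) (permMulAut G n)

/-- The natural action of `G ≀ Sₙ` on `G × [n]`. -/
def wAct {G : Type*} [CommGroup G] {n : ℕ} (w : Wr G n) (p : G × Fin n) : G × Fin n :=
  (p.1 * w.left (w.right p.2), w.right p.2)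

/-- The `i`-th largest part of a multiset of naturals (0-indexed; `0` beyond the last part). -/
def dparts (s : Multiset ℕ) (i : ℕ) : ℕ := ((s.sort (· ≤ ·)).reverse).getD i 0

/-- `s` is dominated by `t`. -/
def msDom (s t : Multiset ℕ) : Prop :=
  ∀ k, (((s.sort (· ≤ ·)).reverse).take k).sum ≤ (((t.sort (· ≤ ·)).reverse).take k).sum

/-- `T` is a `(σ,ρ)`-tabloid: the first component assigns to each element of `[n]` a block
(`Sum.inl i` is the block of the `i+1`-st largest part of `σ`, `Sum.inr j` that of `ρ`),
blocks have the prescribed sizes, and the colouring (second component)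
is normalised to `1` on the `ρ`-blocks. -/
def IsTabloid (G : Type*) [CommGroup G] (n : ℕ) (σ ρ : Multiset ℕ)
    (T : (Fin n → ℕ ⊕ ℕ) × (Fin n → G)) : Prop :=
  (∀ i, Nat.card {a : Fin n // T.1 a = Sum.inl i} = dparts σ i) ∧
  (∀ j, Nat.card {a : Fin n // T.1 a = Sum.inr j} = dparts ρ j) ∧
  (∀ a j, T.1 a = Sum.inr j → T.2 a = 1)

/-- The action of the wreath product on (raw) tabloids. -/
def tabAct {G : Type*} [CommGroup G] {n : ℕ} (w : Wr G n)
    (T : (Fin n → ℕ ⊕ ℕ) × (Fin n → G)) : (Fin n → ℕ ⊕ ℕ) × (Fin n → G) :=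
  ⟨fun a => T.1 (w.right⁻¹ a),
   fun a => match T.1 (w.right⁻¹ a) with
     | Sum.inl _ => T.2 (w.right⁻¹ a) * w.left a
     | Sum.inr _ => 1⟩

/-- A subset `Y` of `W` is transitive on `S ⊆ Ω` (w.r.t. an action `act`): there is a
constant `c > 0` such that any `a ∈ S` is mapped to any `b ∈ S` by exactly `c` elements of `Y`. -/
def IsTransitiveOn {W Ω : Type*} (act : W → Ω → Ω) (S : Set Ω) (Y : Set W) : Prop :=
  ∃ c : ℕ, 0 < c ∧ ∀ a ∈ S, ∀ b ∈ S, Nat.card {y : W // y ∈ Y ∧ act y a = b} = c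

/-- `Y ⊆ G ≀ Sₙ` is `(σ,ρ)`-transitive. -/
def DPTransitive (G : Type*) [CommGroup G] (n : ℕ) (σ ρ : Multiset ℕ)
    (Y : Set (Wr G n)) : Prop :=
  IsTransitiveOn tabAct {T | IsTabloid G n σ ρ T} Y

/-- `(σ,ρ) ≽_G (τ,π)` : every `(σ,ρ)`-transitive subset of `G ≀ Sₙ` is `(τ,π)`-transitive. -/
def DPDom (G : Type*) [CommGroup G] (n : ℕ) (σ ρ τ π : Multiset ℕ) : Prop :=
  ∀ Y : Set (Wr G n), DPTransitive G n σ ρ Y → DPTransitive G n τ π Y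

/-- The partition obtained by adding `k` to the `r`-th largest part (1-indexed). -/
def addPart (s : Multiset ℕ) (r k : ℕ) : Multiset ℕ :=
  s.erase (dparts s (r - 1)) + {dparts s (r - 1) + k}

set_option linter.unusedSectionVars false
namespace LW
open Finset

section Lin
variable {L : Type} [Fintype L] [DecidableEq L] {n : ℕ}

/-- Apply a letter matrix at position `i`. -/
def Dm (i : Fin n) (e : Matrix L L ℚ) : Module.End ℚ ((Fin n → L) → ℚ) where
  toFun f u := ∑ l, e (u i) l * f (Function.update u i l)
  map_add' f g := by
    funext u; simp [mul_add, Finset.sum_add_distrib]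
  map_smul' c f := by
    funext u; simp only [Pi.smul_apply, smul_eq_mul, RingHom.id_apply, Finset.mul_sum]
    exact Finset.sum_congr rfl (fun l _ => by ring)

theorem Dm_apply (i : Fin n) (e : Matrix L L ℚ) (f : (Fin n → L) → ℚ) (u : Fin n → L) :
    Dm i e f u = ∑ l, e (u i) l * f (Function.update u i l) := rfl

theorem Dm_mul (i : Fin n) (e e' : Matrix L L ℚ) : Dm i e * Dm i e' = Dm i (e * e') := by
  refine LinearMap.ext (fun f => funext (fun u => ?_))
  simp only [Module.End.mul_apply, Dm_apply, Function.update_self, Function.update_idem,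
    Matrix.mul_apply, Finset.mul_sum, Finset.sum_mul]
  rw [Finset.sum_comm]
  exact Finset.sum_congr rfl (fun l _ => Finset.sum_congr rfl (fun l' _ => by ring))

theorem Dm_comm (i j : Fin n) (hij : i ≠ j) (e e' : Matrix L L ℚ) :
    Dm i e * Dm j e' = Dm j e' * Dm i e := by
  refine LinearMap.ext (fun f => funext (fun u => ?_))
  simp only [Module.End.mul_apply, Dm_apply, Finset.mul_sum]
  rw [Finset.sum_comm]
  refine Finset.sum_congr rfl (fun l _ => Finset.sum_congr rfl (fun l' _ => ?_))
  rw [Function.update_of_ne hij.symm, Function.update_of_ne hij, Function.update_comm hij]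
  ring

/-- The derivation induced by a letter matrix. -/
def DD (n : ℕ) (e : Matrix L L ℚ) : Module.End ℚ ((Fin n → L) → ℚ) := ∑ i, Dm i e

theorem DD_apply (e : Matrix L L ℚ) (f : (Fin n → L) → ℚ) (u : Fin n → L) :
    DD n e f u = ∑ i, ∑ l, e (u i) l * f (Function.update u i l) := by
  simp [DD, LinearMap.sum_apply, Finset.sum_apply, Dm_apply]

theorem DD_smul (c : ℚ) (e : Matrix L L ℚ) : DD n (c • e) = c • DD n e := by
  refine LinearMap.ext (fun f => funext (fun u => ?_))
  simp only [DD_apply, LinearMap.smul_apply, Pi.smul_apply, Matrix.smul_apply, smul_eq_mul,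
    Finset.mul_sum, mul_assoc]

theorem Dm_sub (i : Fin n) (e e' : Matrix L L ℚ) : Dm i (e - e') = Dm i e - Dm i e' := by
  refine LinearMap.ext (fun f => funext (fun u => ?_))
  simp only [Dm_apply, LinearMap.sub_apply, Pi.sub_apply, Matrix.sub_apply, sub_mul,
    Finset.sum_sub_distrib]

theorem DD_comm (e e' : Matrix L L ℚ) :
    DD n e * DD n e' - DD n e' * DD n e = DD n (e * e' - e' * e) := by
  unfold DD
  rw [Finset.sum_mul_sum, Finset.sum_mul_sum]
  rw [Finset.sum_comm (f := fun i j => Dm i e' * Dm j e)]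
  rw [← Finset.sum_sub_distrib]
  refine Finset.sum_congr rfl (fun i _ => ?_)
  rw [← Finset.sum_sub_distrib, Finset.sum_eq_single i]
  · rw [Dm_mul, Dm_mul, Dm_sub]
  · intro j _ hj
    rw [Dm_comm i j hj.symm, sub_self]
  · simp

variable {B : Type} [DecidableEq B] (blk : L → B)

/-- number of letters of block `b`. -/
def cnt (b : B) (u : Fin n → L) : ℕ := (univ.filter (fun i => blk (u i) = b)).card

theorem cnt_update (b : B) (u : Fin n → L) (i : Fin n) (l : L) :
    cnt blk b (Function.update u i l) + (if blk (u i) = b then 1 else 0)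
      = cnt blk b u + (if blk l = b then 1 else 0) := by
  unfold cnt
  rw [Finset.card_filter, Finset.card_filter, ← Finset.add_sum_erase _ _ (mem_univ i),
    ← Finset.add_sum_erase (a := i) _ (fun x => if blk (u x) = b then 1 else 0) (mem_univ i)]
  have : ∑ x ∈ univ.erase i, (if blk (Function.update u i l x) = b then 1 else 0)
      = ∑ x ∈ univ.erase i, (if blk (u x) = b then 1 else 0) := by
    refine Finset.sum_congr rfl (fun x hx => ?_)
    rw [Function.update_of_ne (Finset.ne_of_mem_erase hx)]
  rw [this, Function.update_self]
  ring

/-- Data for an `sl₂`-type raising operator between blocks `a` and `b`. -/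
structure Sl (a b : B) (c : ℚ) (e f : Matrix L L ℚ) : Prop where
  ne : a ≠ b
  cpos : 0 < c
  he : ∀ x y, e x y ≠ 0 → blk x = b ∧ blk y = a
  hf : ∀ x y, f x y ≠ 0 → blk x = a ∧ blk y = b
  h1 : ∀ x y, blk x = a → (f * e) x y = if x = y then c else 0
  h2 : ∀ x, ∑ y, |(e * f) x y| ≤ c

variable {blk} {a b : B} {c : ℚ} {e f : Matrix L L ℚ}

theorem Sl.fe (h : Sl blk a b c e f) (x y : L) :
    (f * e) x y = if blk x = a ∧ x = y then c else 0 := by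
  by_cases hx : blk x = a
  · simp [h.h1 x y hx, hx]
  · simp only [hx, false_and, if_false, Matrix.mul_apply]
    refine Finset.sum_eq_zero (fun z _ => ?_)
    have : f x z = 0 := by
      by_contra h0; exact hx (h.hf x z h0).1
    simp [this]

theorem Sl.ef (h : Sl blk a b c e f) (x y : L) (hxy : (e * f) x y ≠ 0) :
    blk x = b ∧ blk y = b := by
  rw [Matrix.mul_apply] at hxy
  obtain ⟨z, _, hz⟩ := Finset.exists_ne_zero_of_sum_ne_zero hxy
  exact ⟨(h.he _ _ (left_ne_zero_of_mul hz)).1, (h.hf _ _ (right_ne_zero_of_mul hz)).2⟩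

theorem Sl.ee (h : Sl blk a b c e f) : e * e = 0 := by
  ext x y
  rw [Matrix.mul_apply]
  refine Finset.sum_eq_zero (fun z _ => ?_)
  by_contra h0
  exact h.ne ((h.he _ _ (left_ne_zero_of_mul h0)).2.symm.trans
    (h.he _ _ (right_ne_zero_of_mul h0)).1)

theorem Sl.efe (h : Sl blk a b c e f) : e * (f * e) = c • e := by
  ext x y
  rw [Matrix.mul_apply, Finset.sum_eq_single y]
  · rw [h.fe, Matrix.smul_apply, smul_eq_mul]
    by_cases hy : blk y = a
    · simp [hy, mul_comm]
    · have : e x y = 0 := by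
        by_contra h0; exact hy (h.he x y h0).2
      simp [this]
  · intro z _ hz
    rw [h.fe]; simp [hz]
  · simp

theorem Sl.comm2 (h : Sl blk a b c e f) :
    (f * e - e * f) * e - e * (f * e - e * f) = (-2 * c) • e := by
  have h3 := h.efe
  have h4 : f * e * e = 0 := by rw [mul_assoc, h.ee, mul_zero]
  have h5 : e * (e * f) = 0 := by rw [← mul_assoc, h.ee, zero_mul]
  rw [sub_mul, mul_sub, h4, h5, mul_assoc, h3, mul_smul, neg_smul, two_smul]
  abel

theorem pow_comm {A : Type*} [Ring A] [Algebra ℚ A] (E H : A) (c : ℚ)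
    (h : H * E - E * H = (-2 * c) • E) (k : ℕ) :
    E ^ k * H = H * E ^ k + (2 * c * k) • E ^ k := by
  induction k with
  | zero => simp
  | succ k ih =>
    have h' : E * H = H * E + (2 * c) • E := by
      have : H * E = E * H + (-2 * c) • E := by rw [← h]; abel
      rw [this]; module
    rw [pow_succ, mul_assoc, h', mul_add, ← mul_assoc, ih, add_mul]
    simp only [mul_smul_comm, smul_mul_assoc, mul_assoc]
    push_cast
    module

theorem pow_comm2 {A : Type*} [Ring A] [Algebra ℚ A] (E F H : A) (c : ℚ)
    (h0 : F * E - E * F = H)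
    (h : H * E - E * H = (-2 * c) • E) (m : ℕ) :
    F * E ^ (m + 1) = E ^ (m + 1) * F + ((m : ℚ) + 1) • (E ^ m * (H - (c * m) • 1)) := by
  have h' : F * E = E * F + H := by rw [← h0]; abel
  induction m with
  | zero => simp [h']
  | succ m ih =>
    have h2 : E * H = H * E + (2 * c) • E := by
      have : H * E = E * H + (-2 * c) • E := by rw [← h]; abel
      rw [this]; module
    have h3 : H * E = E * H - (2 * c) • E := by rw [h2]; module
    rw [pow_succ, ← mul_assoc, ih, add_mul, mul_assoc (E ^ (m+1)), h', mul_add]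
    simp only [mul_sub, sub_mul, smul_mul_assoc, mul_smul_comm, mul_one, mul_assoc, h3, smul_sub]
    rw [← mul_assoc (E ^ m) E H, ← pow_succ, ← mul_assoc (E ^ (m+1)) E F, ← pow_succ]
    push_cast
    module

/-- support condition -/
def Sup (a b : B) (blk : L → B) (p q : ℕ) (φ : (Fin n → L) → ℚ) : Prop :=
  ∀ u, φ u ≠ 0 → cnt blk a u = p ∧ cnt blk b u = q

theorem DD_ne {e : Matrix L L ℚ} {φ : (Fin n → L) → ℚ} {u : Fin n → L} (h : DD n e φ u ≠ 0) :
    ∃ i l, e (u i) l ≠ 0 ∧ φ (Function.update u i l) ≠ 0 := by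
  rw [DD_apply] at h
  obtain ⟨i, _, hi⟩ := Finset.exists_ne_zero_of_sum_ne_zero h
  obtain ⟨l, _, hl⟩ := Finset.exists_ne_zero_of_sum_ne_zero hi
  exact ⟨i, l, left_ne_zero_of_mul hl, right_ne_zero_of_mul hl⟩

theorem Sl.supF (h : Sl blk a b c e f) {p q : ℕ} {φ : (Fin n → L) → ℚ}
    (hφ : Sup a b blk p q φ) (u : Fin n → L) (hu : DD n f φ u ≠ 0) :
    cnt blk a u = p + 1 ∧ cnt blk b u + 1 = q := by
  obtain ⟨i, l, h1, h2⟩ := DD_ne hu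
  have h3 := h.hf _ _ h1
  have h4 := hφ _ h2
  have h5 := cnt_update blk a u i l
  have h6 := cnt_update blk b u i l
  rw [h3.1, h3.2, if_pos rfl, if_neg h.ne.symm] at h5
  rw [h3.1, h3.2, if_neg h.ne, if_pos rfl] at h6
  omega

theorem Sl.hdiag (h : Sl blk a b c e f) (x y : L) (hxy : (f * e - e * f) x y ≠ 0) :
    blk x = blk y := by
  rw [Matrix.sub_apply, h.fe] at hxy
  by_cases hx : x = y
  · rw [hx]
  · simp only [hx, and_false, if_false, zero_sub, ne_eq, neg_eq_zero] at hxy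
    have := h.ef x y hxy
    rw [this.1, this.2]

theorem Sl.supH (h : Sl blk a b c e f) {p q : ℕ} {φ : (Fin n → L) → ℚ}
    (hφ : Sup a b blk p q φ) : Sup a b blk p q (DD n (f * e - e * f) φ) := by
  intro u hu
  obtain ⟨i, l, h1, h2⟩ := DD_ne hu
  have h3 := h.hdiag _ _ h1
  have h4 := hφ _ h2
  have h5 := cnt_update blk a u i l
  have h6 := cnt_update blk b u i l
  rw [h3] at h5 h6
  omega

theorem Sl.gersh (h : Sl blk a b c e f) {p q : ℕ} {φ : (Fin n → L) → ℚ}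
    (hφ : Sup a b blk p q φ) (μ : ℚ) (hμ : μ < c * (p - q))
    (hH : DD n (f * e - e * f) φ = μ • φ) : φ = 0 := by
  by_contra hne
  obtain ⟨u0, hu0⟩ := Function.ne_iff.mp hne
  obtain ⟨u, _, hu⟩ := Finset.exists_max_image univ (fun u => |φ u|) ⟨u0, mem_univ _⟩
  have hpos : 0 < |φ u| := lt_of_lt_of_le (abs_pos.mpr hu0) (hu u0 (mem_univ _))
  have hcu := hφ u (abs_pos.mp hpos)
  have h1 := congrFun hH u
  rw [DD_apply, Pi.smul_apply, smul_eq_mul] at h1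
  have h2 : ∀ i, ∑ l, (f * e - e * f) (u i) l * φ (Function.update u i l)
      = (if blk (u i) = a then c * φ u else 0)
        - ∑ l, (e * f) (u i) l * φ (Function.update u i l) := by
    intro i
    simp only [Matrix.sub_apply, sub_mul, Finset.sum_sub_distrib]
    congr 1
    rw [Finset.sum_eq_single (u i)]
    · rw [h.fe, Function.update_eq_self]; simp
    · intro l _ hl
      rw [h.fe]; simp [hl.symm]
    · simp
  have h3 : ∀ i, |∑ l, (e * f) (u i) l * φ (Function.update u i l)|
      ≤ if blk (u i) = b then c * |φ u| else 0 := by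
    intro i
    split_ifs with hb
    · calc _ ≤ ∑ l, |(e * f) (u i) l * φ (Function.update u i l)| := Finset.abs_sum_le_sum_abs _ _
        _ ≤ ∑ l, |(e * f) (u i) l| * |φ u| := by
          refine Finset.sum_le_sum (fun l _ => ?_)
          rw [abs_mul]
          exact mul_le_mul_of_nonneg_left (hu _ (mem_univ _)) (abs_nonneg _)
        _ = (∑ l, |(e * f) (u i) l|) * |φ u| := by rw [Finset.sum_mul]
        _ ≤ c * |φ u| := mul_le_mul_of_nonneg_right (h.h2 _) (abs_nonneg _)
    · rw [Finset.sum_eq_zero, abs_zero]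
      intro l _
      have : (e * f) (u i) l = 0 := by
        by_contra h0; exact hb (h.ef _ _ h0).1
      simp [this]
  simp only [h2, Finset.sum_sub_distrib] at h1
  have h4 : |∑ i, ∑ l, (e * f) (u i) l * φ (Function.update u i l)| ≤ q * (c * |φ u|) := by
    refine (Finset.abs_sum_le_sum_abs _ _).trans ((Finset.sum_le_sum (fun i _ => h3 i)).trans ?_)
    rw [← Finset.sum_filter, Finset.sum_const, nsmul_eq_mul, ← hcu.2]
    rfl
  have h5 : ∑ i, (if blk (u i) = a then c * φ u else 0) = p * (c * φ u) := by
    rw [← Finset.sum_filter, Finset.sum_const, nsmul_eq_mul, ← hcu.1]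
    rfl
  rw [h5] at h1
  have h6 : ∑ i, ∑ l, (e * f) (u i) l * φ (Function.update u i l) = (p * c - μ) * φ u := by
    linarith
  rw [h6, abs_mul] at h4
  have h7 := le_abs_self (p * c - μ)
  have : (p * c - μ) * |φ u| ≤ q * c * |φ u| := by nlinarith
  have := le_of_mul_le_mul_right this hpos
  linarith

theorem Sl.inj (h : Sl blk a b c e f) : ∀ (q p m : ℕ) (φ : (Fin n → L) → ℚ), m + q ≤ p →
    Sup a b blk p q φ → (DD n e ^ m) φ = 0 → φ = 0 := by
  have c1 : DD n f * DD n e - DD n e * DD n f = DD n (f * e - e * f) := DD_comm f e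
  have c2 : DD n (f * e - e * f) * DD n e - DD n e * DD n (f * e - e * f)
      = (-2 * c) • DD n e := by
    rw [DD_comm, h.comm2, DD_smul]
  intro q
  induction q with
  | zero =>
    intro p m
    induction m with
    | zero => intro φ _ _ h0; simpa using h0
    | succ m ih =>
      intro φ hpq hφ h0
      have hF : DD n f φ = 0 := by
        by_contra hne
        obtain ⟨u0, hu0⟩ := Function.ne_iff.mp hne
        have := (h.supF hφ u0 hu0).2
        omega
      have k1 := congrArg (fun T : Module.End ℚ _ => T φ) (pow_comm2 _ _ _ c c1 c2 m)
      simp only [Module.End.mul_apply, LinearMap.add_apply, LinearMap.smul_apply, h0, hF, map_zero,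
        zero_add] at k1
      have k2 := (smul_eq_zero.mp k1.symm).resolve_left (by positivity)
      have k3 := ih _ (by omega) (by
        intro u hu
        rw [LinearMap.sub_apply, LinearMap.smul_apply, Module.End.one_apply, Pi.sub_apply,
          Pi.smul_apply, smul_eq_mul] at hu
        by_cases hz : φ u = 0
        · exact h.supH hφ u (by simpa [hz] using hu)
        · exact hφ u hz) k2
      refine h.gersh hφ (c * m) ?_ (by
        rw [LinearMap.sub_apply, LinearMap.smul_apply, Module.End.one_apply] at k3
        exact sub_eq_zero.mp k3)
      refine mul_lt_mul_of_pos_left ?_ h.cpos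
      have : ((m + 1 + 0 : ℕ) : ℚ) ≤ p := by exact_mod_cast hpq
      push_cast at this ⊢
      linarith
  | succ q ihq =>
    intro p m
    induction m with
    | zero => intro φ _ _ h0; simpa using h0
    | succ m ih =>
      intro φ hpq hφ h0
      have k1 := congrArg (fun T : Module.End ℚ _ => T φ) (pow_comm2 _ _ _ c c1 c2 m)
      simp only [Module.End.mul_apply, LinearMap.add_apply, LinearMap.smul_apply, h0, map_zero]
        at k1
      have hF : DD n f φ = 0 := by
        refine ihq (p + 1) (m + 3) _ (by omega) (fun u hu => ?_) ?_
        · have := h.supF hφ u hu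
          omega
        · have k4 : (DD n e ^ (m + 3)) (DD n f φ) = (DD n e ^ 2) ((DD n e ^ (m + 1)) (DD n f φ)) := by
            rw [← Module.End.mul_apply (DD n e ^ 2), ← pow_add]; congr 2; ring
          have k5 : (DD n e ^ (m + 1)) (DD n f φ) = - (((m : ℚ) + 1) • (DD n e ^ m)
              ((DD n (f * e - e * f) - (c * m) • (1 : Module.End ℚ ((Fin n → L) → ℚ))) φ)) :=
            eq_neg_of_add_eq_zero_left k1.symm
          have k7 : (DD n e ^ (m + 2)) φ = 0 := by
            rw [show m + 2 = 1 + (m + 1) by ring, pow_add, Module.End.mul_apply, h0, map_zero]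
          have k6 := congrArg (fun T : Module.End ℚ _ => T φ) (pow_comm _ _ c c2 (m + 2))
          simp only [Module.End.mul_apply, LinearMap.add_apply, LinearMap.smul_apply, k7, map_zero,
            smul_zero, add_zero] at k6
          rw [k4, k5, map_neg, map_smul, ← Module.End.mul_apply (DD n e ^ 2), ← pow_add,
            show 2 + m = m + 2 by ring, LinearMap.sub_apply, map_sub, k6,
            LinearMap.smul_apply, map_smul, Module.End.one_apply, k7]
          simp
      rw [hF, map_zero, zero_add] at k1
      have k2 := (smul_eq_zero.mp k1.symm).resolve_left (by positivity)
      have k3 := ih _ (by omega) (by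
        intro u hu
        rw [LinearMap.sub_apply, LinearMap.smul_apply, Module.End.one_apply, Pi.sub_apply,
          Pi.smul_apply, smul_eq_mul] at hu
        by_cases hz : φ u = 0
        · exact h.supH hφ u (by simpa [hz] using hu)
        · exact hφ u hz) k2
      refine h.gersh hφ (c * m) ?_ (by
        rw [LinearMap.sub_apply, LinearMap.smul_apply, Module.End.one_apply] at k3
        exact sub_eq_zero.mp k3)
      refine mul_lt_mul_of_pos_left ?_ h.cpos
      have : ((m + 1 + (q + 1) : ℕ) : ℚ) ≤ p := by exact_mod_cast hpq
      push_cast at this ⊢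
      linarith

theorem Sl.supE (h : Sl blk a b c e f) {κ : B → ℕ} {φ : (Fin n → L) → ℚ}
    (hφ : ∀ u, φ u ≠ 0 → ∀ d, cnt blk d u = κ d) (m : ℕ) : ∀ u, (DD n e ^ m) φ u ≠ 0 →
    cnt blk a u + m = κ a ∧ cnt blk b u = κ b + m ∧ ∀ d, d ≠ a → d ≠ b → cnt blk d u = κ d := by
  induction m with
  | zero =>
    intro u hu
    have := hφ u (by simpa using hu)
    exact ⟨this a, this b, fun d _ _ => this d⟩
  | succ m ih =>
    intro u hu
    rw [pow_succ', Module.End.mul_apply] at hu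
    obtain ⟨i, l, h1, h2⟩ := DD_ne hu
    have h3 := h.he _ _ h1
    obtain ⟨k1, k2, k3⟩ := ih _ h2
    refine ⟨?_, ?_, fun d da db => ?_⟩
    · have h5 := cnt_update blk a u i l
      rw [h3.1, h3.2, if_neg h.ne.symm, if_pos rfl] at h5
      omega
    · have h5 := cnt_update blk b u i l
      rw [h3.1, h3.2, if_pos rfl, if_neg h.ne] at h5
      omega
    · have h5 := cnt_update blk d u i l
      have := k3 d da db
      rw [h3.1, h3.2, if_neg db.symm, if_neg da.symm] at h5
      omega

end Lin

section Word
variable {ι : Type} [Fintype ι] [DecidableEq ι] {G : Type} [CommGroup G] [Fintype G]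
  [DecidableEq G] {n : ℕ}

/-- Letter action. -/
def lact (g : G) : Option (ι × G) ≃ Option (ι × G) :=
  Equiv.optionCongr (Equiv.prodCongr (Equiv.refl ι) (Equiv.mulRight g))

/-- Block of a letter. -/
def bl : Option (ι × G) → Option ι := Option.map Prod.fst

@[simp] theorem lact_none (g : G) : lact g (none : Option (ι × G)) = none := rfl
@[simp] theorem lact_some (g : G) (i : ι) (c : G) :
    lact g (some (i, c) : Option (ι × G)) = some (i, c * g) := rfl
@[simp] theorem bl_none : bl (none : Option (ι × G)) = none := rfl
@[simp] theorem bl_some (i : ι) (c : G) : bl (some (i, c) : Option (ι × G)) = some i := rfl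

theorem bl_lact (g : G) (x : Option (ι × G)) : bl (lact g x) = bl x := by
  rcases x with _ | ⟨i, c⟩ <;> rfl

/-- Action on words. -/
def wact (w : Wr G n) (u : Fin n → Option (ι × G)) : Fin n → Option (ι × G) :=
  fun a => lact (w.left a) (u (w.right⁻¹ a))

theorem cnt_wact (w : Wr G n) (u : Fin n → Option (ι × G)) (b : Option ι) :
    cnt bl b (wact w u) = cnt bl b u := by
  unfold cnt
  symm
  refine Finset.card_equiv w.right (fun i => ?_)
  simp [wact, bl_lact]

noncomputable instance : Fintype (Wr G n) :=
  Fintype.ofEquiv _ (SemidirectProduct.equivProd (φ := permMulAut G n)).symm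

/-- Pullback operator. -/
def PW (w : Wr G n) : Module.End ℚ ((Fin n → Option (ι × G)) → ℚ) where
  toFun f u := f (wact w u)
  map_add' _ _ := rfl
  map_smul' _ _ := rfl

theorem wact_update (w : Wr G n) (u : Fin n → Option (ι × G)) (i : Fin n) (l : Option (ι × G)) :
    wact w (Function.update u i l)
      = Function.update (wact w u) (w.right i) (lact (w.left (w.right i)) l) := by
  funext a
  by_cases ha : a = w.right i
  · subst ha; simp [wact]
  · rw [Function.update_of_ne ha]
    have : w.right⁻¹ a ≠ i := by
      intro h; apply ha; rw [← h]; simp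
    simp only [wact]
    rw [Function.update_of_ne this]

theorem PW_DD (w : Wr G n) (e : Matrix (Option (ι × G)) (Option (ι × G)) ℚ)
    (he : ∀ g x y, e (lact g x) (lact g y) = e x y) :
    DD n e * PW w = PW w * DD n e := by
  refine LinearMap.ext (fun f => funext (fun u => ?_))
  simp only [Module.End.mul_apply]
  change DD n e (fun u => f (wact w u)) u = DD n e f (wact w u)
  rw [DD_apply, DD_apply, ← Equiv.sum_comp w.right (fun i => ∑ l, e (wact w u i) l * f (Function.update (wact w u) i l))]
  refine Finset.sum_congr rfl (fun i _ => ?_)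
  rw [← Equiv.sum_comp (lact (ι := ι) (w.left (w.right i)))
    (fun l => e (wact w u (w.right i)) l * f (Function.update (wact w u) (w.right i) l))]
  refine Finset.sum_congr rfl (fun l _ => ?_)
  have : wact w u (w.right i) = lact (w.left (w.right i)) (u i) := by simp [wact]
  rw [this, he, wact_update]

/-- Support on the words of content `κ`. -/
def SupK (κ : Option ι → ℕ) (φ : (Fin n → Option (ι × G)) → ℚ) : Prop :=
  ∀ u, φ u ≠ 0 → ∀ d, cnt bl d u = κ d

/-- Weighted sum of group elements kills functions of content `κ`. -/
def Kill (z : Wr G n → ℚ) (κ : Option ι → ℕ) : Prop :=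
  ∀ φ : (Fin n → Option (ι × G)) → ℚ, SupK κ φ → (∑ w, z w • PW w) φ = 0

theorem kill_step (z : Wr G n → ℚ) (κ κ' : Option ι → ℕ) (a b : Option ι) (c : ℚ)
    (e f : Matrix (Option (ι × G)) (Option (ι × G)) ℚ) (h : Sl bl a b c e f)
    (he : ∀ g x y, e (lact g x) (lact g y) = e x y) (m : ℕ)
    (ha : κ a + m = κ' a) (hb : κ b = κ' b + m) (hd : ∀ d, d ≠ a → d ≠ b → κ d = κ' d)
    (hm : m + κ' b ≤ κ' a) (hK : Kill z κ) : Kill z κ' := by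
  intro φ hφ
  have hc : Commute (DD n e) (∑ w, z w • PW w) := by
    refine Commute.sum_right _ _ _ (fun w _ => ?_)
    exact Commute.smul_right (PW_DD w e he) _
  have hc' : DD n e ^ m * (∑ w, z w • PW w) = (∑ w, z w • PW w) * DD n e ^ m := hc.pow_left m
  refine h.inj (κ' b) (κ' a) m _ hm ?_ ?_
  · intro u hu
    simp only [LinearMap.sum_apply, Finset.sum_apply, LinearMap.smul_apply, Pi.smul_apply] at hu
    obtain ⟨w, _, hw⟩ := Finset.exists_ne_zero_of_sum_ne_zero hu
    have h1 := hφ _ (right_ne_zero_of_smul hw)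
    rw [← cnt_wact w u, ← cnt_wact w u]
    exact ⟨h1 a, h1 b⟩
  · rw [← Module.End.mul_apply, hc', Module.End.mul_apply]
    refine hK _ (fun u hu => ?_)
    obtain ⟨h1, h2, h3⟩ := h.supE hφ m u hu
    intro d
    by_cases hda : d = a
    · subst hda; omega
    · by_cases hdb : d = b
      · subst hdb; omega
      · rw [h3 d hda hdb, hd d hda hdb]

theorem sl_none (j : ι) : Sl (bl (ι := ι) (G := G)) none (some j) (Fintype.card G)
    (Matrix.of fun x y => if bl x = some j ∧ y = none then 1 else 0)
    (Matrix.of fun x y => if bl y = some j ∧ x = none then 1 else 0) where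
  ne := by simp
  cpos := by exact_mod_cast Fintype.card_pos
  he x y h := by
    simp only [Matrix.of_apply, ne_eq, ite_eq_right_iff, Classical.not_imp] at h
    exact ⟨h.1.1, by rw [h.1.2]; rfl⟩
  hf x y h := by
    simp only [Matrix.of_apply, ne_eq, ite_eq_right_iff, Classical.not_imp] at h
    exact ⟨by rw [h.1.2]; rfl, h.1.1⟩
  h1 x y h := by
    rcases x with _ | ⟨i, c⟩
    · rw [Matrix.mul_apply, Fintype.sum_option, Fintype.sum_prod_type]
      rcases y with _ | ⟨i', c'⟩
      · simp
      · simp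
    · simp at h
  h2 x := by
    rw [Fintype.sum_option, Fintype.sum_prod_type]
    have key : ∀ x y, (((Matrix.of fun x y => if bl x = some j ∧ y = none then (1:ℚ) else 0) *
        (Matrix.of fun x y => if bl y = some j ∧ x = none then (1:ℚ) else 0) :
        Matrix (Option (ι × G)) (Option (ι × G)) ℚ)) x y
        = if bl x = some j ∧ bl y = some j then 1 else 0 := by
      intro x y
      rw [Matrix.mul_apply, Fintype.sum_option]
      simp [ite_and]
      split_ifs <;> rfl
    simp only [key]
    by_cases hx : bl x = some j
    · simp [hx, apply_ite abs]
    · simp [hx]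

theorem sl_some (i j : ι) (hij : i ≠ j) : Sl (bl (ι := ι) (G := G)) (some i) (some j) 1
    (Matrix.of fun x y => if ∃ c, x = some (j, c) ∧ y = some (i, c) then 1 else 0)
    (Matrix.of fun x y => if ∃ c, y = some (j, c) ∧ x = some (i, c) then 1 else 0) where
  ne := by simpa using hij
  cpos := one_pos
  he x y h := by
    simp only [Matrix.of_apply, ne_eq, ite_eq_right_iff, Classical.not_imp] at h
    obtain ⟨⟨c, rfl, rfl⟩, _⟩ := h
    exact ⟨rfl, rfl⟩
  hf x y h := by
    simp only [Matrix.of_apply, ne_eq, ite_eq_right_iff, Classical.not_imp] at h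
    obtain ⟨⟨c, rfl, rfl⟩, _⟩ := h
    exact ⟨rfl, rfl⟩
  h1 x y h := by
    rcases x with _ | ⟨i', c⟩
    · simp at h
    · have : i' = i := by simpa using h
      subst this
      rw [Matrix.mul_apply, Finset.sum_eq_single (some (j, c))]
      · simp [eq_comm]
      · intro z _ hz
        simp only [Matrix.of_apply]
        rw [if_neg, zero_mul]
        rintro ⟨c', rfl, h2⟩
        simp at h2
        exact hz (by rw [h2])
      · simp
  h2 x := by
    have key : ∀ x y, (((Matrix.of fun x y => if ∃ c, x = some (j, c) ∧ y = some (i, c) then (1:ℚ) else 0) *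
        (Matrix.of fun x y => if ∃ c, y = some (j, c) ∧ x = some (i, c) then (1:ℚ) else 0) :
        Matrix (Option (ι × G)) (Option (ι × G)) ℚ)) x y
        = if x = y ∧ bl x = some j then 1 else 0 := by
      intro x y
      by_cases hx : bl x = some j
      · rcases x with _ | ⟨j', c⟩
        · simp at hx
        · have : j' = j := by simpa using hx
          subst this
          rw [Matrix.mul_apply, Finset.sum_eq_single (some (i, c))]
          · simp [eq_comm]
          · intro z _ hz
            simp only [Matrix.of_apply]
            rw [if_neg, zero_mul]
            rintro ⟨c', h2, rfl⟩
            simp at h2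
            exact hz (by rw [h2])
          · simp
      · rw [Matrix.mul_apply, if_neg (fun h => hx h.2)]
        refine Finset.sum_eq_zero (fun z _ => ?_)
        simp only [Matrix.of_apply]
        rw [if_neg, zero_mul]
        rintro ⟨c', rfl, _⟩
        exact hx rfl
    simp only [key]
    rw [Finset.sum_eq_single x]
    · split_ifs <;> simp
    · intro y _ hy
      simp [hy.symm]
    · simp

theorem kill_move (z : Wr G n → ℚ) (κ κ' : Option ι → ℕ) (a : Option ι) (j : ι)
    (haj : a ≠ some j) (m : ℕ)
    (ha : κ a + m = κ' a) (hb : κ (some j) = κ' (some j) + m)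
    (hd : ∀ d, d ≠ a → d ≠ some j → κ d = κ' d)
    (hm : m + κ' (some j) ≤ κ' a) (hK : Kill z κ) : Kill z κ' := by
  rcases a with _ | i
  · refine kill_step z κ κ' _ _ _ _ _ (sl_none j) ?_ m ha hb hd hm hK
    intro g x y
    simp only [Matrix.of_apply, bl_lact]
    rcases y with _ | y <;> simp [lact]
  · refine kill_step z κ κ' _ _ _ _ _ (sl_some i j (by simpa using haj)) ?_ m ha hb hd hm hK
    intro g x y
    simp only [Matrix.of_apply]
    congr 1
    rcases x with _ | ⟨x, c⟩ <;> rcases y with _ | ⟨y, c'⟩ <;> simp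
end Word

theorem perm_of_cards {α γ : Type} [Fintype α] [DecidableEq γ] (f g : α → γ)
    (h : ∀ x, (univ.filter (fun a => f a = x)).card = (univ.filter (fun a => g a = x)).card) :
    ∃ π : Equiv.Perm α, ∀ a, g (π a) = f a := by
  have e : ∀ x, Nonempty ({a // f a = x} ≃ {a // g a = x}) := by
    intro x
    refine Fintype.card_eq.mp ?_
    rw [Fintype.card_subtype, Fintype.card_subtype, h x]
  exact ⟨Equiv.ofFiberEquiv (fun x => (e x).some), fun a => Equiv.ofFiberEquiv_map _ a⟩

section Comb
variable {ι : Type} [Fintype ι] [DecidableEq ι]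

/-- Sum of excesses over `x`. -/
def Ff (s : Option ι → ℕ) (x : ℕ) : ℕ := ∑ b, (s b - x)

/-- number of entries larger than `x`. -/
def gt (s : Option ι → ℕ) (x : ℕ) : ℕ := (univ.filter (fun b => x < s b)).card

theorem Ff_succ (s : Option ι → ℕ) (x : ℕ) : Ff s x = Ff s (x + 1) + gt s x := by
  unfold Ff gt
  rw [Finset.card_filter, ← Finset.sum_add_distrib]
  refine Finset.sum_congr rfl (fun b _ => ?_)
  split_ifs <;> omega

theorem gt_split (s : Option ι → ℕ) (x y : ℕ) (h : x ≤ y) :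
    gt s x = (univ.filter (fun b => x < s b ∧ s b ≤ y)).card + gt s y := by
  unfold gt
  rw [Finset.card_filter, Finset.card_filter, Finset.card_filter, ← Finset.sum_add_distrib]
  refine Finset.sum_congr rfl (fun b _ => ?_)
  split_ifs <;> omega

theorem gt_zero (s : Option ι → ℕ) :
    Fintype.card (Option ι) = (univ.filter (fun b => s b = 0)).card + gt s 0 := by
  unfold gt
  rw [Finset.card_filter, Finset.card_filter, ← Finset.sum_add_distrib, Fintype.card,
    Finset.card_eq_sum_ones]
  refine Finset.sum_congr rfl (fun b _ => ?_)
  split_ifs <;> omega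

theorem cards_eq (s t : Option ι → ℕ) (h : ∀ x, Ff s x = Ff t x) (x : ℕ) :
    (univ.filter (fun b => s b = x)).card = (univ.filter (fun b => t b = x)).card := by
  have hg : ∀ x, gt s x = gt t x := by
    intro x
    have := Ff_succ s x
    have := Ff_succ t x
    have := h x
    have := h (x + 1)
    omega
  rcases x with _ | x
  · have := gt_zero s
    have := gt_zero t
    have := hg 0
    omega
  · have h1 := gt_split s x (x + 1) (by omega)
    have h2 := gt_split t x (x + 1) (by omega)
    have e1 : ∀ s : Option ι → ℕ, (univ.filter (fun b => x < s b ∧ s b ≤ x + 1))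
        = univ.filter (fun b => s b = x + 1) := by
      intro s; ext b; simp; omega
    rw [e1] at h1 h2
    have := hg x
    have := hg (x + 1)
    omega

theorem Ff_raise (s s' : Option ι → ℕ) (a b : Option ι) (hab : a ≠ b) (ha : s' a = s a + 1)
    (hb : s' b + 1 = s b) (hd : ∀ d, d ≠ a → d ≠ b → s' d = s d) (hle : s b ≤ s a) (x : ℕ) :
    Ff s' x = Ff s x + if s b ≤ x ∧ x ≤ s a then 1 else 0 := by
  unfold Ff
  have hb' : b ∈ univ.erase a := by simp [hab.symm]
  rw [← Finset.add_sum_erase _ _ (mem_univ a), ← Finset.add_sum_erase _ _ hb',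
    ← Finset.add_sum_erase (a := a) _ (fun b => s b - x) (mem_univ a),
    ← Finset.add_sum_erase _ (fun b => s b - x) hb']
  have : ∑ d ∈ (univ.erase a).erase b, (s' d - x) = ∑ d ∈ (univ.erase a).erase b, (s d - x) := by
    refine Finset.sum_congr rfl (fun d hd' => ?_)
    simp only [mem_erase, mem_univ, and_true] at hd'
    rw [hd d hd'.2 hd'.1]
  rw [this]
  split_ifs <;> omega

/-- closure under moves. -/
def MoveClosed (R : (Option ι → ℕ) → Prop) : Prop :=
  ∀ (κ κ' : Option ι → ℕ) (a : Option ι) (j : ι), a ≠ some j → ∀ m : ℕ,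
    κ a + m = κ' a → κ (some j) = κ' (some j) + m → (∀ d, d ≠ a → d ≠ some j → κ d = κ' d) →
    m + κ' (some j) ≤ κ' a → R κ → R κ'

theorem MoveClosed.swap {R : (Option ι → ℕ) → Prop} (hR : MoveClosed R) (s : Option ι → ℕ)
    (a : Option ι) (j : ι) (haj : a ≠ some j) (hle : s a ≤ s (some j)) (h : R s) :
    R (s ∘ Equiv.swap a (some j)) := by
  refine hR s _ a j haj (s (some j) - s a) ?_ ?_ ?_ ?_ h
  · simp; omega
  · simp; omega
  · intro d h1 h2; simp [Equiv.swap_apply_of_ne_of_ne h1 h2]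
  · simp; omega

theorem MoveClosed.perm {R : (Option ι → ℕ) → Prop} (hR : MoveClosed R) (π : Equiv.Perm ι) :
    ∀ s, R s → R (s ∘ Option.map π) := by
  induction π using Equiv.Perm.swap_induction_on with
  | one => intro s h; simpa using h
  | swap_mul f x y hxy ih =>
    intro s h
    have key : R (s ∘ Equiv.swap (some x) (some y)) := by
      rcases le_total (s (some x)) (s (some y)) with hl | hl
      · exact hR.swap s (some x) y (by simpa using hxy) hl h
      · rw [Equiv.swap_comm]
        exact hR.swap s (some y) x (by simpa using hxy.symm) hl h
    have := ih _ key
    convert this using 1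
    funext d
    rcases d with _ | d
    · simp [Equiv.swap_apply_of_ne_of_ne]
    · simp only [Function.comp, Option.map_some, Equiv.Perm.mul_apply]
      rw [Equiv.swap_apply_def, Equiv.swap_apply_def]
      simp only [Option.some.injEq]
      split_ifs <;> rfl

/-- A unit raise. -/
theorem MoveClosed.raise {R : (Option ι → ℕ) → Prop} (hR : MoveClosed R) (s : Option ι → ℕ)
    (a : Option ι) (j : ι) (haj : a ≠ some j) (hpos : 1 ≤ s (some j)) (hle : s (some j) ≤ s a)
    (h : R s) :
    ∃ s', R s' ∧ s' a = s a + 1 ∧ (none ≠ a → s' none = s none) ∧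
      ∀ x, Ff s' x = Ff s x + if s (some j) ≤ x ∧ x ≤ s a then 1 else 0 := by
  have e1 : Function.update (Function.update s a (s a + 1)) (some j) (s (some j) - 1) a = s a + 1 := by
    rw [Function.update_of_ne haj, Function.update_self]
  have e2 : Function.update (Function.update s a (s a + 1)) (some j) (s (some j) - 1) (some j)
      = s (some j) - 1 := by
    rw [Function.update_self]
  have e3 : ∀ d, d ≠ a → d ≠ some j →
      Function.update (Function.update s a (s a + 1)) (some j) (s (some j) - 1) d = s d := by
    intro d h1 h2
    rw [Function.update_of_ne h2, Function.update_of_ne h1]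
  refine ⟨Function.update (Function.update s a (s a + 1)) (some j) (s (some j) - 1), ?_, e1, ?_, ?_⟩
  · refine hR s _ a j haj 1 (by omega) (by omega) (fun d h1 h2 => (e3 d h1 h2).symm) (by omega) h
  · intro hne; exact e3 none hne (by simp)
  · intro x
    exact Ff_raise s _ a (some j) haj e1 (by omega) e3 hle x

theorem Ff_big (t : Option ι → ℕ) (x : ℕ) (hx : Ff t 0 ≤ x) : Ff t x = 0 := by
  unfold Ff at *
  refine Finset.sum_eq_zero (fun b _ => ?_)
  have := Finset.single_le_sum (f := fun b => t b - 0) (fun _ _ => Nat.zero_le _) (mem_univ b)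
  omega

theorem chain {R : (Option ι → ℕ) → Prop} (hR : MoveClosed R) (t : Option ι → ℕ) :
    ∀ (N : ℕ) (s : Option ι → ℕ),
    (t none - s none) + ∑ x ∈ range (Ff t 0 + 1), (Ff t x - Ff s x) ≤ N → s none ≤ t none →
    (∀ x, Ff s x ≤ Ff t x) → Ff s 0 = Ff t 0 → R s → R t := by
  intro N
  induction N using Nat.strong_induction_on with
  | _ N ih =>
  intro s hN h0 hle heq hs
  -- swap case
  by_cases hsw : ∃ j, s none < s (some j) ∧ s (some j) ≤ t none
  · obtain ⟨j, hj1, hj2⟩ := hsw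
    have hFf : ∀ x, Ff (s ∘ Equiv.swap none (some j)) x = Ff s x := by
      intro x
      exact Equiv.sum_comp (Equiv.swap none (some j)) (fun b => s b - x)
    have hn : (s ∘ Equiv.swap none (some j)) none = s (some j) := by simp
    refine ih _ ?_ (s ∘ Equiv.swap none (some j)) le_rfl (by rw [hn]; exact hj2)
      (fun x => by rw [hFf]; exact hle x) (by rw [hFf]; exact heq)
      (hR.swap s none j (by simp) hj1.le hs)
    simp only [hFf, hn]
    omega
  push Not at hsw
  by_cases hD : ∃ x, Ff s x < Ff t x
  · obtain ⟨x, hx⟩ := hD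
    -- the left end
    obtain ⟨p, hp1, hp2⟩ : ∃ p, Ff s p = Ff t p ∧ p < x ∧ ∀ y, p < y → y ≤ x → Ff s y < Ff t y := by
      refine ⟨Nat.findGreatest (fun y => Ff s y = Ff t y) x, ?_, ?_, ?_⟩
      · exact Nat.findGreatest_spec (P := fun y => Ff s y = Ff t y) (Nat.zero_le x) heq
      · have h1 := Nat.findGreatest_le (P := fun y => Ff s y = Ff t y) x
        have h2 := Nat.findGreatest_spec (P := fun y => Ff s y = Ff t y) (Nat.zero_le x) heq
        rcases h1.lt_or_eq with h | h
        · exact h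
        · rw [h] at h2; omega
      · intro y hy1 hy2
        have := Nat.findGreatest_is_greatest hy1 hy2
        exact lt_of_le_of_ne (hle y) this
    have hex : ∃ y, x < y ∧ Ff s y = Ff t y := by
      refine ⟨x + 1 + Ff t 0, by omega, ?_⟩
      have h1 := Ff_big t (x + 1 + Ff t 0) (by omega)
      have h2 := hle (x + 1 + Ff t 0)
      omega
    obtain ⟨q, hq1, hq2, hq3⟩ : ∃ q, Ff s (q + 1) = Ff t (q + 1) ∧ x ≤ q ∧
        ∀ y, x < y → y ≤ q → Ff s y < Ff t y := by
      have h1 := Nat.find_spec hex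
      refine ⟨Nat.find hex - 1, ?_, by omega, ?_⟩
      · rw [Nat.sub_add_cancel (by omega)]; exact h1.2
      · intro y hy1 hy2
        have := Nat.find_min hex (m := y) (by omega)
        exact lt_of_le_of_ne (hle y) (fun h => this ⟨hy1, h⟩)
    have hpos : ∀ y, p < y → y ≤ q → Ff s y < Ff t y := by
      intro y h1 h2
      rcases le_or_gt y x with h | h
      · exact hp2.2 y h1 h
      · exact hq3 y h h2
    have hpq : p < q := by omega
    have cs := gt_split s p q hpq.le
    have ct := gt_split t p q hpq.le
    have a1 := Ff_succ s p
    have a2 := Ff_succ t p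
    have a3 := Ff_succ s q
    have a4 := Ff_succ t q
    have a5 := hpos (p + 1) (by omega) (by omega)
    have a6 := hpos q hpq le_rfl
    have hcard : (univ.filter (fun b => p < t b ∧ t b ≤ q)).card + 2
        ≤ (univ.filter (fun b => p < s b ∧ s b ≤ q)).card := by omega
    -- general raising step
    have fin : ∀ (a : Option ι) (j : ι), a ≠ some j → p < s (some j) → s (some j) ≤ s a → s a ≤ q →
        (a = none → s none < t none) → R t := by
      intro a j haj k1 k2 k3 k4
      obtain ⟨s', r1, r2, r3, r4⟩ := hR.raise s a j haj (by omega) k2 hs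
      have hle' : ∀ y, Ff s' y ≤ Ff t y := by
        intro y
        rw [r4]
        split_ifs with hy
        · exact hpos y (by omega) (by omega)
        · exact hle y
      have hn1 : s none ≤ s' none ∧ s' none ≤ t none := by
        rcases a with _ | i
        · have := k4 rfl; omega
        · have := r3 (by simp); omega
      refine ih _ ?_ s' le_rfl hn1.2 hle' ?_ r1
      · refine lt_of_lt_of_le ?_ hN
        refine add_lt_add_of_le_of_lt (by omega) ?_
        refine Finset.sum_lt_sum (fun y _ => ?_) ⟨s (some j), ?_, ?_⟩
        · rw [r4]; omega
        · rw [mem_range]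
          by_contra hcon
          have := Ff_big t (s (some j)) (by omega)
          have := hpos (s (some j)) (by omega) (by omega)
          omega
        · have := hpos (s (some j)) (by omega) (by omega)
          rw [r4, if_pos ⟨le_rfl, k2⟩]; omega
      · rw [r4, if_neg (by omega)]; exact heq
    by_cases htwo : ∃ i j, i ≠ j ∧ (p < s (some i) ∧ s (some i) ≤ q) ∧
        (p < s (some j) ∧ s (some j) ≤ q)
    · obtain ⟨i, j, hij, hi, hj⟩ := htwo
      rcases le_total (s (some j)) (s (some i)) with hl | hl
      · exact fin (some i) j (by simpa using hij) hj.1 hl hi.2 (by simp)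
      · exact fin (some j) i (by simpa using hij.symm) hi.1 hl hj.2 (by simp)
    · have hone : (univ.filter (fun i : ι => p < s (some i) ∧ s (some i) ≤ q)).card ≤ 1 := by
        rw [Finset.card_le_one]
        intro i hi j hj
        by_contra hne
        exact htwo ⟨i, j, hne, by simpa using hi, by simpa using hj⟩
      rw [Finset.card_filter, Finset.card_filter, Fintype.sum_option, Fintype.sum_option,
        ← Finset.card_filter, ← Finset.card_filter] at hcard
      have hnone : p < s none ∧ s none ≤ q := by
        by_contra hc
        rw [if_neg hc] at hcard
        omega
      rw [if_pos hnone] at hcard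
      have htn : ¬ (p < t none ∧ t none ≤ q) := by
        intro hc
        rw [if_pos hc] at hcard
        omega
      have hex1 : 0 < (univ.filter (fun i : ι => p < s (some i) ∧ s (some i) ≤ q)).card := by omega
      obtain ⟨j, hj⟩ := Finset.card_pos.mp hex1
      simp only [mem_filter, mem_univ, true_and] at hj
      have hj2 : s (some j) ≤ s none := by
        by_contra hc
        have := hsw j (by omega)
        omega
      exact fin none j (by simp) hj.1 hj2 hnone.2 (fun _ => by omega)
  · have hall : ∀ x, Ff s x = Ff t x := by
      intro x
      by_contra hne
      exact hD ⟨x, lt_of_le_of_ne (hle x) hne⟩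
    have hc := cards_eq s t hall
    rcases h0.lt_or_eq with h0 | h0
    · have h1 := hc (t none)
      have h2 : 0 < (univ.filter (fun b => t b = t none)).card :=
        Finset.card_pos.mpr ⟨none, by simp⟩
      rw [← h1] at h2
      obtain ⟨d, hd⟩ := Finset.card_pos.mp h2
      simp only [mem_filter, mem_univ, true_and] at hd
      rcases d with _ | d
      · omega
      · have := hsw d (by omega)
        omega
    · obtain ⟨π, hπ⟩ := perm_of_cards (fun i => t (some i)) (fun i => s (some i)) (by
        intro x
        have h1 := hc x
        rw [Finset.card_filter, Finset.card_filter, Fintype.sum_option, Fintype.sum_option,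
          ← Finset.card_filter, ← Finset.card_filter, h0] at h1
        exact (Nat.add_left_cancel h1).symm)
      have := hR.perm π s hs
      convert this using 1
      funext d
      rcases d with _ | d
      · exact h0.symm
      · exact (hπ d).symm

end Comb

section Trans
variable {ι : Type} [Fintype ι] [DecidableEq ι] {G : Type} [CommGroup G] [Fintype G]
  [DecidableEq G] {n : ℕ}

theorem wact_mul (w w' : Wr G n) (u : Fin n → Option (ι × G)) :
    wact (w * w') u = wact w (wact w' u) := by
  funext a
  have h1 : (w * w').left a = w.left a * w'.left (w.right⁻¹ a) := by
    rw [SemidirectProduct.mul_left]; rfl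
  simp only [wact, h1, SemidirectProduct.mul_right, mul_inv_rev, Equiv.Perm.mul_apply]
  rcases u (w'.right⁻¹ (w.right⁻¹ a)) with _ | ⟨i, c⟩
  · rfl
  · simp only [lact_some]; congr 2; rw [mul_assoc, mul_comm (w.left a)]

theorem wact_one (u : Fin n → Option (ι × G)) : wact (1 : Wr G n) u = u := by
  funext a
  simp only [wact, SemidirectProduct.one_left, SemidirectProduct.one_right, inv_one,
    Equiv.Perm.one_apply, Pi.one_apply]
  rcases u a with _ | ⟨i, c⟩ <;> simp

theorem exists_lact (x y : Option (ι × G)) (h : bl x = bl y) : ∃ g : G, lact g x = y := by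
  rcases x with _ | ⟨i, c⟩ <;> rcases y with _ | ⟨j, d⟩
  · exact ⟨1, rfl⟩
  · simp at h
  · simp at h
  · have : i = j := by simpa using h
    subst this
    exact ⟨c⁻¹ * d, by simp⟩

theorem exists_wact (u v : Fin n → Option (ι × G)) (h : ∀ d, cnt bl d u = cnt bl d v) :
    ∃ w : Wr G n, wact w u = v := by
  obtain ⟨π, hπ⟩ := perm_of_cards (fun a => bl (u a)) (fun a => bl (v a)) h
  have : ∀ a, ∃ g : G, lact g (u (π⁻¹ a)) = v a := by
    intro a
    refine exists_lact _ _ ?_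
    have := hπ (π⁻¹ a)
    rw [← Equiv.Perm.mul_apply, mul_inv_cancel, Equiv.Perm.one_apply] at this
    exact this.symm
  choose g hg using this
  exact ⟨⟨g, π⟩, funext hg⟩

/-- words of content `κ`. -/
def Om (κ : Option ι → ℕ) (u : Fin n → Option (ι × G)) : Prop := ∀ d, cnt bl d u = κ d

open Classical in
/-- number of elements of `Y` mapping `u` to `v`. -/
noncomputable def NY (Y : Finset (Wr G n)) (u v : Fin n → Option (ι × G)) : ℕ :=
  (Y.filter (fun y => wact y u = v)).card

open Classical in
theorem NW_const (κ : Option ι → ℕ) (u v u' v' : Fin n → Option (ι × G)) (hu : Om κ u)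
    (hv : Om κ v) (hu' : Om κ u') (hv' : Om κ v') :
    NY (univ : Finset (Wr G n)) u v = NY univ u' v' := by
  obtain ⟨s, hs⟩ := exists_wact u u' (fun d => (hu d).trans (hu' d).symm)
  obtain ⟨t, ht⟩ := exists_wact v v' (fun d => (hv d).trans (hv' d).symm)
  unfold NY
  refine Finset.card_equiv ((Equiv.mulRight s⁻¹).trans (Equiv.mulLeft t)) (fun w => ?_)
  simp only [mem_filter, mem_univ, true_and, Equiv.trans_apply, Equiv.coe_mulRight,
    Equiv.coe_mulLeft]
  have h1 : wact s⁻¹ u' = u := by rw [← hs, ← wact_mul, inv_mul_cancel, wact_one]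
  rw [wact_mul, wact_mul, h1, ← ht]
  constructor
  · intro h; rw [h]
  · intro h
    have := congrArg (wact t⁻¹) h
    rwa [← wact_mul, ← wact_mul t⁻¹ t v, inv_mul_cancel, wact_one, wact_one] at this

open Classical in
theorem NW_pos (κ : Option ι → ℕ) (u v : Fin n → Option (ι × G)) (hu : Om κ u)
    (hv : Om κ v) : 0 < NY (univ : Finset (Wr G n)) u v := by
  obtain ⟨s, hs⟩ := exists_wact u v (fun d => (hu d).trans (hv d).symm)
  exact Finset.card_pos.mpr ⟨s, by simp [hs]⟩

open Classical in
theorem sum_NY (Y : Finset (Wr G n)) (κ : Option ι → ℕ) (u : Fin n → Option (ι × G))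
    (hu : Om κ u) : Y.card = ∑ v ∈ univ.filter (fun v => Om κ v), NY Y u v := by
  unfold NY
  refine Finset.card_eq_sum_card_fiberwise (fun y _ => ?_)
  simp only [coe_filter, mem_univ, true_and, Set.mem_ofPred_eq]
  intro d
  rw [cnt_wact]; exact hu d

open Classical in
/-- the weight attached to `Y`. -/
noncomputable def zY (Y : Finset (Wr G n)) (w : Wr G n) : ℚ :=
  (Fintype.card (Wr G n) : ℚ) * (if w ∈ Y then 1 else 0) - Y.card

open Classical in
theorem sum_zY (Y : Finset (Wr G n)) (u v : Fin n → Option (ι × G)) :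
    ∑ w, (if wact w u = v then zY Y w else 0)
      = (Fintype.card (Wr G n) : ℚ) * NY Y u v - Y.card * NY univ u v := by
  unfold NY
  rw [Finset.card_filter, Finset.card_filter]
  push_cast
  rw [Finset.mul_sum, Finset.mul_sum, ← Finset.sum_filter_add_sum_filter_not univ (fun w => w ∈ Y)]
  have : ∑ y ∈ Y, (Fintype.card (Wr G n) : ℚ) * (if wact y u = v then 1 else 0)
      = ∑ w, (if w ∈ Y then (Fintype.card (Wr G n) : ℚ) * (if wact w u = v then 1 else 0) else 0) := by
    rw [← Finset.sum_filter]; congr 1; ext; simp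
  rw [this, ← Finset.sum_sub_distrib, Finset.sum_filter_add_sum_filter_not]
  refine Finset.sum_congr rfl (fun w _ => ?_)
  unfold zY
  split_ifs <;> simp

open Classical in
theorem kill_apply (Y : Finset (Wr G n)) (φ : (Fin n → Option (ι × G)) → ℚ)
    (u : Fin n → Option (ι × G)) :
    (∑ w, zY Y w • PW w) φ u = ∑ v, φ v * ((Fintype.card (Wr G n) : ℚ) * NY Y u v
      - Y.card * NY univ u v) := by
  simp only [LinearMap.sum_apply, Finset.sum_apply, LinearMap.smul_apply, Pi.smul_apply,
    smul_eq_mul, ← sum_zY, Finset.mul_sum]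
  rw [Finset.sum_comm]
  refine Finset.sum_congr rfl (fun w _ => ?_)
  rw [Finset.sum_eq_single (wact w u)]
  · simp [PW, mul_comm]
  · intro v _ hv; simp [hv.symm]
  · simp

open Classical in
theorem kill_of_trans (Y : Finset (Wr G n)) (κ : Option ι → ℕ) (c : ℕ)
    (h : ∀ u v : Fin n → Option (ι × G), Om κ u → Om κ v → NY Y u v = c) :
    Kill (ι := ι) (zY Y) κ := by
  intro φ hφ
  funext u
  rw [kill_apply]
  refine Finset.sum_eq_zero (fun v _ => ?_)
  by_cases hv0 : φ v = 0
  · simp [hv0]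
  have hv : Om κ v := hφ v hv0
  by_cases hu : Om κ u
  · have h1 := sum_NY Y κ u hu
    have h2 := sum_NY (univ : Finset (Wr G n)) κ u hu
    rw [Finset.sum_congr rfl (fun v hv => h u v hu (by simpa using hv)),
      Finset.sum_const, smul_eq_mul] at h1
    rw [Finset.sum_congr rfl (fun v' hv' => NW_const κ u v' u v hu (by simpa using hv') hu hv),
      Finset.sum_const, smul_eq_mul, Finset.card_univ] at h2
    rw [h1, h2, h u v hu hv]
    push_cast
    ring
  · have : ∀ Z : Finset (Wr G n), NY Z u v = 0 := by
      intro Z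
      unfold NY
      rw [Finset.card_eq_zero, Finset.filter_eq_empty_iff]
      intro w _ hw
      apply hu
      intro d
      rw [← cnt_wact w u, hw]; exact hv d
    simp [this]

open Classical in
theorem trans_of_kill (Y : Finset (Wr G n)) (hY : Y.Nonempty) (κ : Option ι → ℕ)
    (h : Kill (ι := ι) (zY Y) κ) :
    ∃ c : ℕ, 0 < c ∧ ∀ u v : Fin n → Option (ι × G), Om κ u → Om κ v → NY Y u v = c := by
  have key : ∀ u v : Fin n → Option (ι × G), Om κ u → Om κ v →
      Fintype.card (Wr G n) * NY Y u v = Y.card * NY univ u v := by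
    intro u v hu hv
    have h1 := congrFun (h (fun v' => if v' = v then 1 else 0) (by
      intro v' hv'
      simp only [ne_eq, ite_eq_right_iff, Classical.not_imp] at hv'
      rw [hv'.1]; exact hv)) u
    rw [kill_apply] at h1
    simp only [ite_mul, one_mul, zero_mul, Finset.sum_ite_eq', mem_univ, if_true,
      Pi.zero_apply] at h1
    have h2 := sub_eq_zero.mp h1
    exact_mod_cast h2
  by_cases hne : ∃ u : Fin n → Option (ι × G), Om κ u
  · obtain ⟨u0, hu0⟩ := hne
    refine ⟨NY Y u0 u0, ?_, ?_⟩
    · have h1 := key u0 u0 hu0 hu0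
      have h2 := Nat.mul_pos (Finset.card_pos.mpr hY) (NW_pos κ u0 u0 hu0 hu0)
      rw [← h1] at h2
      exact Nat.pos_of_mul_pos_left h2
    · intro u v hu hv
      have h1 := key u0 u0 hu0 hu0
      have h2 := key u v hu hv
      rw [NW_const κ u v u0 u0 hu hv hu0 hu0, ← h1] at h2
      exact Nat.eq_of_mul_eq_mul_left Fintype.card_pos h2
  · exact ⟨1, one_pos, fun u v hu _ => absurd ⟨u, hu⟩ hne⟩

theorem exists_Om (κ : Option ι → ℕ) (h : ∑ d, κ d = n) :
    ∃ u : Fin n → Option (ι × G), Om κ u := by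
  have hc : Fintype.card (Fin n) = Fintype.card (Σ d : Option ι, Fin (κ d)) := by
    simp [h]
  obtain ⟨E⟩ := Fintype.card_eq.mp hc
  refine ⟨fun a => (E a).1.map (fun i => (i, 1)), fun d => ?_⟩
  unfold cnt
  have : ∀ a, bl ((E a).1.map (fun i => (i, (1 : G)))) = (E a).1 := by
    intro a
    rcases (E a).1 with _ | i <;> rfl
  simp only [this]
  have e2 : (univ.filter (fun a => (E a).1 = d)).card
      = (univ.filter (fun x : Σ d : Option ι, Fin (κ d) => x.1 = d)).card :=
    Finset.card_equiv E (fun a => by simp)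
  rw [e2]
  have e3 : (univ.filter (fun x : Σ d : Option ι, Fin (κ d) => x.1 = d))
      = (univ : Finset (Fin (κ d))).map ⟨fun i => ⟨d, i⟩, fun i j h => by simpa using h⟩ := by
    ext ⟨d', i⟩
    simp only [mem_filter, mem_univ, true_and, mem_map, Function.Embedding.coeFn_mk]
    constructor
    · rintro rfl; exact ⟨i, rfl⟩
    · rintro ⟨j, hj⟩; exact (congrArg Sigma.fst hj).symm
  rw [e3, Finset.card_map, Finset.card_univ, Fintype.card_fin]
end Trans

section Final

theorem list_sum_getD (g : ℕ → ℕ) (g0 : g 0 = 0) : ∀ (l : List ℕ) (N : ℕ), l.length ≤ N →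
    ∑ i ∈ range N, g (l.getD i 0) = (l.map g).sum := by
  intro l
  induction l with
  | nil => intro N _; simp [g0]
  | cons x l ih =>
    intro N hN
    rcases N with _ | N
    · simp at hN
    · rw [Finset.sum_range_succ']
      simp only [List.getD_cons_succ, List.getD_cons_zero, List.map_cons, List.sum_cons]
      rw [ih N (by simpa using hN), add_comm]

theorem sum_dparts (g : ℕ → ℕ) (g0 : g 0 = 0) (s : Multiset ℕ) (N : ℕ) (hN : s.card ≤ N) :
    ∑ i : Fin N, g (dparts s i) = (s.map g).sum := by
  rw [Fin.sum_univ_eq_sum_range (fun i => g (dparts s i)) N]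
  unfold dparts
  rw [list_sum_getD g g0 _ N (by simpa using hN), List.map_reverse, List.sum_reverse]
  conv_rhs => rw [← Multiset.sort_eq s (· ≤ ·)]
  rw [Multiset.map_coe, Multiset.sum_coe]

theorem dparts_big (s : Multiset ℕ) (i : ℕ) (h : s.card ≤ i) : dparts s i = 0 := by
  unfold dparts
  exact List.getD_eq_default _ _ (by simpa using h)

theorem take_le (x : ℕ) : ∀ (l : List ℕ) (M : ℕ),
    (l.take M).sum ≤ (l.map (fun a => a - x)).sum + M * x := by
  intro l
  induction l with
  | nil => intro M; simp
  | cons a l ih =>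
    intro M
    rcases M with _ | M
    · simp
    · have := ih M
      simp only [List.take_succ_cons, List.sum_cons, List.map_cons, Nat.add_mul]
      omega

theorem take_ge (x : ℕ) : ∀ (l : List ℕ), l.Pairwise (fun a b => b ≤ a) →
    ∃ M, (l.map (fun a => a - x)).sum + M * x ≤ (l.take M).sum := by
  intro l
  induction l with
  | nil => intro _; exact ⟨0, by simp⟩
  | cons a l ih =>
    intro h
    rw [List.pairwise_cons] at h
    by_cases hax : x ≤ a
    · obtain ⟨M, hM⟩ := ih h.2
      refine ⟨M + 1, ?_⟩
      simp only [List.take_succ_cons, List.sum_cons, List.map_cons, Nat.add_mul]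
      omega
    · refine ⟨0, ?_⟩
      have : ((a :: l).map (fun a => a - x)).sum = 0 := by
        rw [List.sum_eq_zero_iff]
        intro y hy
        rw [List.mem_map] at hy
        obtain ⟨b, hb, rfl⟩ := hy
        rcases List.mem_cons.mp hb with rfl | hb
        · omega
        · have := h.1 b hb; omega
      rw [this]; simp

theorem dom_Ff (s t : Multiset ℕ) (h : msDom s t) (x : ℕ) :
    (s.map (fun a => a - x)).sum ≤ (t.map (fun a => a - x)).sum := by
  have hs : ∀ s : Multiset ℕ, (s.map (fun a => a - x)).sum
      = (((s.sort (· ≤ ·)).reverse).map (fun a => a - x)).sum := by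
    intro s
    conv_lhs => rw [← Multiset.sort_eq s (· ≤ ·)]
    rw [Multiset.map_coe, Multiset.sum_coe, List.map_reverse, List.sum_reverse]
  rw [hs, hs]
  obtain ⟨M, hM⟩ := take_ge x ((s.sort (· ≤ ·)).reverse) (by
    rw [List.pairwise_reverse]
    exact Multiset.pairwise_sort s (· ≤ ·))
  have := take_le x ((t.sort (· ≤ ·)).reverse) M
  have := h M
  omega

variable {G : Type} [CommGroup G] [Fintype G] [DecidableEq G] {n N : ℕ}

/-- Word to tabloid. -/
def toTab (u : Fin n → Option (Fin N × G)) : (Fin n → ℕ ⊕ ℕ) × (Fin n → G) :=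
  (fun a => (u a).elim (Sum.inr 0) (fun p => Sum.inl p.1.val), fun a => (u a).elim 1 Prod.snd)

theorem toTab_act (w : Wr G n) (u : Fin n → Option (Fin N × G)) :
    tabAct w (toTab u) = toTab (wact w u) := by
  unfold tabAct toTab wact
  refine Prod.ext (funext fun a => ?_) (funext fun a => ?_)
  · simp only
    rcases u (w.right⁻¹ a) with _ | ⟨i, c⟩ <;> rfl
  · simp only
    rcases u (w.right⁻¹ a) with _ | ⟨i, c⟩ <;> rfl

theorem toTab_inj : Function.Injective (toTab : (Fin n → Option (Fin N × G)) → _) := by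
  intro u v h
  funext a
  have h1 := congrFun (congrArg Prod.fst h) a
  have h2 := congrFun (congrArg Prod.snd h) a
  simp only [toTab] at h1 h2
  rcases hu : u a with _ | ⟨i, c⟩ <;> rcases hv : v a with _ | ⟨j, d⟩ <;>
    simp_all
  exact Fin.ext h1

/-- content attached to `(σ,(k))`. -/
def kap (N : ℕ) (σ : Multiset ℕ) (k : ℕ) : Option (Fin N) → ℕ
  | none => k
  | some i => dparts σ i

theorem dparts_sing (k j : ℕ) : dparts {k} j = if j = 0 then k else 0 := by
  unfold dparts
  rcases j with _ | j <;> simp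

theorem tab_iff (σ : Multiset ℕ) (k : ℕ) (hN : σ.card ≤ N) (u : Fin n → Option (Fin N × G)) :
    IsTabloid G n σ {k} (toTab u) ↔ Om (kap N σ k) u := by
  have c1 : ∀ i : Fin N, Nat.card {a : Fin n // (toTab u).1 a = Sum.inl i.val} = cnt bl (some i) u := by
    intro i
    rw [Nat.card_eq_fintype_card, Fintype.card_subtype]
    unfold cnt
    congr 1
    ext a
    rw [Finset.mem_filter, Finset.mem_filter]
    simp only [mem_univ, true_and, toTab]
    rcases u a with _ | ⟨j, c⟩
    · simp
    · simp [Fin.ext_iff]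
  have c2 : Nat.card {a : Fin n // (toTab u).1 a = Sum.inr 0} = cnt bl none u := by
    rw [Nat.card_eq_fintype_card, Fintype.card_subtype]
    unfold cnt
    congr 1
    ext a
    rw [Finset.mem_filter, Finset.mem_filter]
    simp only [mem_univ, true_and, toTab]
    rcases u a with _ | ⟨j, c⟩
    · simp
    · simp
  constructor
  · rintro ⟨h1, h2, _⟩ d
    rcases d with _ | i
    · rw [← c2, h2, dparts_sing]; rfl
    · rw [← c1, h1]; rfl
  · intro h
    refine ⟨fun i => ?_, fun j => ?_, fun a j => ?_⟩
    · by_cases hi : i < N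
      · exact (c1 ⟨i, hi⟩).trans (h (some ⟨i, hi⟩))
      · rw [dparts_big _ _ (by omega)]
        rw [Nat.card_eq_zero]
        left
        refine ⟨fun ⟨a, ha⟩ => ?_⟩
        simp only [toTab] at ha
        rcases hu : u a with _ | ⟨j, c⟩
        · simp [hu] at ha
        · simp only [hu, Option.elim_some, Sum.inl.injEq] at ha
          have := j.isLt
          omega
    · rw [dparts_sing]
      split_ifs with hj
      · subst hj; exact c2.trans (h none)
      · rw [Nat.card_eq_zero]
        left
        refine ⟨fun ⟨a, ha⟩ => ?_⟩
        simp only [toTab] at ha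
        rcases hu : u a with _ | ⟨j', c⟩
        · simp only [hu, Option.elim_none, Sum.inr.injEq] at ha
          exact hj ha.symm
        · simp [hu] at ha
    · simp only [toTab]
      rcases hu : u a with _ | ⟨j', c⟩ <;> simp

theorem tab_surj (σ : Multiset ℕ) (k : ℕ) (hN : σ.card ≤ N) (T : (Fin n → ℕ ⊕ ℕ) × (Fin n → G))
    (hT : IsTabloid G n σ {k} T) : ∃ u : Fin n → Option (Fin N × G), toTab u = T := by
  obtain ⟨h1, h2, h3⟩ := hT
  have : ∀ a, ∃ x : Option (Fin N × G), x.elim (Sum.inr 0) (fun p => Sum.inl p.1.val) = T.1 a ∧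
      x.elim 1 Prod.snd = T.2 a := by
    intro a
    rcases ha : T.1 a with i | j
    · have hi : i < N := by
        by_contra hc
        have h := h1 i
        rw [dparts_big _ _ (by omega)] at h
        rcases Nat.card_eq_zero.mp h with h | h
        · exact h.false ⟨a, ha⟩
        · exact h.not_finite inferInstance
      exact ⟨some (⟨i, hi⟩, T.2 a), rfl, rfl⟩
    · have hj : j = 0 := by
        by_contra hc
        have h := h2 j
        rw [dparts_sing, if_neg hc] at h
        rcases Nat.card_eq_zero.mp h with h | h
        · exact h.false ⟨a, ha⟩
        · exact h.not_finite inferInstance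
      subst hj
      exact ⟨none, rfl, (h3 a 0 ha).symm⟩
  choose u hu using this
  exact ⟨u, Prod.ext (funext fun a => (hu a).1) (funext fun a => (hu a).2)⟩

open Classical in
theorem card_tab (Y : Set (Wr G n)) (u v : Fin n → Option (Fin N × G)) :
    Nat.card {y : Wr G n // y ∈ Y ∧ tabAct y (toTab u) = toTab v} = NY Y.toFinset u v := by
  rw [Nat.card_eq_fintype_card, Fintype.card_subtype]
  unfold NY
  congr 1
  ext y
  simp [toTab_act, toTab_inj.eq_iff]

open Classical in
theorem DP_iff (Y : Set (Wr G n)) (σ : Multiset ℕ) (k : ℕ) (hN : σ.card ≤ N) :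
    DPTransitive G n σ {k} Y ↔ ∃ c : ℕ, 0 < c ∧ ∀ u v : Fin n → Option (Fin N × G),
      Om (kap N σ k) u → Om (kap N σ k) v → NY Y.toFinset u v = c := by
  unfold DPTransitive IsTransitiveOn
  refine exists_congr (fun c => and_congr_right (fun _ => ?_))
  constructor
  · intro h u v hu hv
    rw [← card_tab]
    exact h _ ((tab_iff σ k hN u).mpr hu) _ ((tab_iff σ k hN v).mpr hv)
  · intro h a ha b hb
    obtain ⟨u, rfl⟩ := tab_surj σ k hN a ha
    obtain ⟨v, rfl⟩ := tab_surj σ k hN b hb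
    rw [card_tab]
    exact h u v ((tab_iff σ k hN u).mp ha) ((tab_iff σ k hN v).mp hb)

theorem Ff_kap (σ : Multiset ℕ) (k : ℕ) (hN : σ.card ≤ N) (x : ℕ) :
    Ff (kap N σ k) x = ((σ + {k}).map (fun a => a - x)).sum := by
  unfold Ff
  rw [Fintype.sum_option, Multiset.map_add, Multiset.sum_add, Multiset.map_singleton,
    Multiset.sum_singleton, add_comm]
  congr 1
  exact sum_dparts (fun a => a - x) (by simp) σ N hN

open Classical in
theorem main (σ τ : Multiset ℕ) (k ℓ : ℕ) (hσ : σ.sum + k = n) (hτ : τ.sum + ℓ = n)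
    (Y : Set (Wr G n)) (hY : DPTransitive G n σ {k} Y)
    (hkℓ : k ≤ ℓ) (hdom : msDom (σ + {k}) (τ + {ℓ})) : DPTransitive G n τ {ℓ} Y := by
  have hN1 : σ.card ≤ σ.card + τ.card := by omega
  have hN2 : τ.card ≤ σ.card + τ.card := by omega
  rw [DP_iff Y σ k hN1] at hY
  rw [DP_iff Y τ ℓ hN2]
  obtain ⟨c, hc, h⟩ := hY
  have hF0 : ∀ (σ : Multiset ℕ) (k : ℕ), ((σ + {k}).map (fun a => a - 0)).sum = σ.sum + k := by
    intro σ k; simp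
  have hsum : ∑ d, kap (σ.card + τ.card) σ k d = n := by
    have h1 := Ff_kap σ k hN1 0
    rw [hF0, hσ] at h1
    simpa [Ff] using h1
  obtain ⟨u0, hu0⟩ := exists_Om (G := G) (kap (σ.card + τ.card) σ k) hsum
  have hne : Y.toFinset.Nonempty := by
    have h1 := h u0 u0 hu0 hu0
    rw [← h1] at hc
    obtain ⟨y, hy⟩ := Finset.card_pos.mp hc
    exact ⟨y, (Finset.mem_filter.mp hy).1⟩
  have hK := kill_of_trans Y.toFinset _ c h
  refine trans_of_kill Y.toFinset hne _ ?_
  have hR : MoveClosed (Kill (ι := Fin (σ.card + τ.card)) (zY Y.toFinset)) := by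
    intro κ κ' a j haj m ha hb hd hm hK
    exact kill_move _ κ κ' a j haj m ha hb hd hm hK
  refine chain hR _ _ (kap (σ.card + τ.card) σ k) le_rfl hkℓ (fun x => ?_) ?_ hK
  · rw [Ff_kap _ _ hN1, Ff_kap _ _ hN2]
    exact dom_Ff _ _ hdom x
  · rw [Ff_kap _ _ hN1, Ff_kap _ _ hN2, hF0, hF0, hσ, hτ]

end Final
end LW


/-- **Livingstone–Wagner type theorem for the hyperoctahedral group.**
Let `n ≥ 1`, let `k, ℓ ≤ n` be nonnegative integers, `σ` a partition of `n - k`,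
`τ` a partition of `n - ℓ`, and let `Y` be a `(σ,(k))`-transitive subset of the
hyperoctahedral group `C₂ ≀ Sₙ`.  If `k ≤ ℓ` and `σ ∪ (k) ⊴ τ ∪ (ℓ)`, then `Y` is
also `(τ,(ℓ))`-transitive. -/
theorem livingstone_wagner_cube (n k ℓ : ℕ) (hn : 1 ≤ n) (hk : k ≤ n) (hℓ : ℓ ≤ n)
    (σ τ : Multiset ℕ) (hσ0 : 0 ∉ σ) (hτ0 : 0 ∉ τ)
    (hσ : σ.sum + k = n) (hτ : τ.sum + ℓ = n)
    (Y : Set (Wr (Multiplicative (ZMod 2)) n))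
    (hY : DPTransitive (Multiplicative (ZMod 2)) n σ {k} Y)
    (hkℓ : k ≤ ℓ) (hdom : msDom (σ + {k}) (τ + {ℓ})) :
    DPTransitive (Multiplicative (ZMod 2)) n τ {ℓ} Y := by
  exact LW.main σ τ k ℓ hσ hτ Y hY hkℓ hdom
end

section
/- Let r ≥ 1 and n ≥ 1 be integers and let k be an integer with 0 ≤ k ≤ n/2. Then the class function on C_r ≀ S_n given by g ↦ C_k^{(1/r)}(θ(g)) is a character of C_r ≀ S_n; that is, there exists a finite-dimensional complex representation of C_r ≀ S_n whose character equals this function. -/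
/-- `θ(w)`: the number of fixed points of `w` on `C_r × [n]`, divided by `r`. -/
noncomputable def theta {r n : ℕ} (w : Wr (Multiplicative (ZMod r)) n) : ℕ :=
  Nat.card {p : Multiplicative (ZMod r) × Fin n // wAct w p = p} / r

/-- The Charlier polynomial `C_k^{(a)}(x) = ∑_{j=0}^k (-1)^{k-j} binom(k,j) a^{-j} (x)_j`. -/
noncomputable def charlier (a : ℝ) (k : ℕ) (x : ℝ) : ℝ :=
  ∑ j ∈ Finset.range (k + 1),
    (-1 : ℝ) ^ (k - j) * (k.choose j : ℝ) * a⁻¹ ^ j * ∏ m ∈ Finset.range j, (x - m)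

/-- `Y` is a `t`-design in `C_r ≀ Sₙ`: it is transitive on `t`-tuples of elements of
`C_r × [n]` with pairwise distinct second coordinates. -/
def IsTDesign (r n t : ℕ) (Y : Set (Wr (Multiplicative (ZMod r)) n)) : Prop :=
  IsTransitiveOn (fun w v => fun s => wAct w (v s))
    {v : Fin t → Multiplicative (ZMod r) × Fin n | Function.Injective fun s => (v s).2} Y

/-- `Y` is a `d`-code in `C_r ≀ Sₙ` : `θ(x⁻¹y) ≤ n - d` for all distinct `x, y ∈ Y`. -/
def IsDCode (r n d : ℕ) (Y : Set (Wr (Multiplicative (ZMod r)) n)) : Prop :=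
  ∀ x ∈ Y, ∀ y ∈ Y, x ≠ y → (theta (x⁻¹ * y) : ℤ) ≤ (n : ℤ) - d


open Function

namespace Charl

variable {ι Pt β R : Type*}

/-- `f` depends only on the coordinates in `A`. -/
def Dep (A : Finset ι) (f : (ι → Pt) → R) : Prop :=
  ∀ x y : ι → Pt, (∀ a ∈ A, x a = y a) → f x = f y

/-- `x` has pairwise distinct base points in `T` on the coordinates in `A`. -/
def Good (π : Pt → β) (T : Finset β) (A : Finset ι) (x : ι → Pt) : Prop :=
  (∀ a ∈ A, π (x a) ∈ T) ∧ (∀ a ∈ A, ∀ b ∈ A, π (x a) = π (x b) → a = b)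

theorem key [DecidableEq ι] [DecidableEq β] [AddCommGroup R] (π : Pt → β)
    (hπ : Surjective π) (T : Finset β) :
    ∀ (B S : Finset ι) (i : ι) (f : (ι → Pt) → R) (h : ι → (ι → Pt) → R),
      S ⊆ B → i ∉ B → B.card + S.card + 1 ≤ T.card → Dep B f →
      (∀ j ∈ S, Dep (insert i (B.erase j)) (h j)) →
      (∀ x, Good π T (insert i B) x → f x = ∑ j ∈ S, h j x) →
      ∃ h' : ι → (ι → Pt) → R, (∀ j ∈ S, Dep (B.erase j) (h' j)) ∧
        ∀ x, Good π T B x → f x = ∑ j ∈ S, h' j x := by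
  induction T using Finset.induction_on with
  | empty => intro B S i f h _ _ hc; simp at hc
  | insert p T hp ih =>
    intro B S i f h hSB hi hc hf hh hx
    rw [Finset.card_insert_of_notMem hp] at hc
    obtain ⟨y0, hy0⟩ := hπ p
    have hi' : ∀ b ∈ B, b ≠ i := fun b hb e => hi (e ▸ hb)
    have claim : ∀ b z, b ∈ B → π z = p → ∃ H : ι → (ι → Pt) → R,
        (∀ j ∈ S.erase b, Dep ((B.erase b).erase j) (H j)) ∧
        ∀ x, Good π T (B.erase b) x →
          f (update x b z) = (if b ∈ S then h b (update x i y0) else 0)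
            + ∑ j ∈ S.erase b, H j x := by
      intro b z hb hz
      have hBc : (B.erase b).card + 1 = B.card := Finset.card_erase_add_one hb
      by_cases hbS : b ∈ S
      · have hSc : (S.erase b).card + 1 = S.card := Finset.card_erase_add_one hbS
        set q : (ι → Pt) → R := fun x => f (update x b z) - h b (update x i y0) with hq
        have hqd : Dep (B.erase b) q := by
          intro x y hxy
          simp only [hq]
          congr 1
          · apply hf
            intro a ha
            by_cases hab : a = b
            · subst hab; simp
            · simp [hab, hxy a (Finset.mem_erase.2 ⟨hab, ha⟩)]
          · apply hh b hbS
            intro a ha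
            by_cases hai : a = i
            · subst hai; simp
            · simp only [update_of_ne hai]
              exact hxy a (Finset.mem_of_mem_insert_of_ne ha hai)
        obtain ⟨H1, H1d, H1e⟩ := ih B (S.erase b) i q
          (fun j x => h j (update x b z) - h j x + h j (update x i y0))
          ((Finset.erase_subset _ _).trans hSB) hi (by omega)
          (fun x y hxy => hqd x y fun a ha => hxy a (Finset.mem_of_mem_erase ha))
          (by
            intro j hj x y hxy
            have hjS := Finset.mem_of_mem_erase hj
            have e1 : h j (update x b z) = h j (update y b z) := by
              apply hh j hjS
              intro a ha
              by_cases hab : a = b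
              · subst hab; simp
              · simp [hab, hxy a ha]
            have e2 : h j (update x i y0) = h j (update y i y0) := by
              apply hh j hjS
              intro a ha
              by_cases hab : a = i
              · subst hab; simp
              · simp [hab, hxy a ha]
            simp only [e1, e2, hh j hjS x y hxy])
          (by
            intro x ⟨hx1, hx2⟩
            have g1 : f x = ∑ j ∈ S, h j x :=
              hx x ⟨fun a ha => Finset.mem_insert_of_mem (hx1 a ha), hx2⟩
            have g2 : f (update x b z) = ∑ j ∈ S, h j (update x b z) := by
              apply hx
              constructor
              · intro a ha
                by_cases hab : a = b
                · subst hab; simp [hz]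
                · simp only [update_of_ne hab]
                  exact Finset.mem_insert_of_mem (hx1 a ha)
              · intro a ha c hc' e
                by_cases hab : a = b <;> by_cases hcb : c = b
                · rw [hab, hcb]
                · subst hab
                  rw [update_self, update_of_ne hcb, hz] at e
                  exact absurd (e ▸ hx1 c hc') hp
                · subst hcb
                  rw [update_self, update_of_ne hab, hz] at e
                  exact absurd (e ▸ hx1 a ha) hp
                · rw [update_of_ne hcb, update_of_ne hab] at e
                  exact hx2 a ha c hc' e
            have g3 : f (update x i y0) = ∑ j ∈ S, h j (update x i y0) := by
              apply hx
              constructor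
              · intro a ha
                by_cases hab : a = i
                · subst hab; simp [hy0]
                · simp only [update_of_ne hab]
                  exact Finset.mem_insert_of_mem (hx1 a ha)
              · intro a ha c hc' e
                by_cases hab : a = i <;> by_cases hcb : c = i
                · rw [hab, hcb]
                · subst hab
                  rw [update_self, update_of_ne hcb, hy0] at e
                  exact absurd (e ▸ hx1 c hc') hp
                · subst hcb
                  rw [update_self, update_of_ne hab, hy0] at e
                  exact absurd (e ▸ hx1 a ha) hp
                · rw [update_of_ne hcb, update_of_ne hab] at e
                  exact hx2 a ha c hc' e
            have g4 : f (update x i y0) = f x := by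
              apply hf
              intro a ha
              rw [update_of_ne (hi' a ha)]
            have g5 : h b (update x b z) = h b x := by
              apply hh b hbS
              intro a ha
              have : a ≠ b := by
                rintro rfl
                simp only [Finset.mem_insert, Finset.mem_erase, ne_eq, not_true_eq_false,
                  false_and, or_false] at ha
                exact hi' a hb ha
              rw [update_of_ne this]
            rw [← Finset.add_sum_erase _ _ hbS] at g1 g2 g3
            simp only [hq, Finset.sum_add_distrib, Finset.sum_sub_distrib]
            rw [g2, g5]
            rw [g4, g1] at g3
            have : ∑ j ∈ S.erase b, h j (update x i y0) =
              h b x + ∑ j ∈ S.erase b, h j x - h b (update x i y0) := by rw [g3]; abel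
            rw [this]; abel)
        obtain ⟨H2, H2d, H2e⟩ := ih (B.erase b) (S.erase b) b q H1
          (Finset.erase_subset_erase _ hSB) (Finset.notMem_erase _ _) (by omega) hqd
          (by
            intro j hj x y hxy
            apply H1d j hj
            intro a ha
            apply hxy
            simp only [Finset.mem_insert, Finset.mem_erase] at ha ⊢
            tauto)
          (by
            intro x hg
            rw [Finset.insert_erase hb] at hg
            exact H1e x hg)
        refine ⟨H2, H2d, fun x hg => ?_⟩
        rw [← H2e x hg, if_pos hbS]
        simp [hq]
      · rw [Finset.erase_eq_of_notMem hbS]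
        obtain ⟨H2, H2d, H2e⟩ := ih (B.erase b) S i (fun x => f (update x b z))
          (fun j x => h j (update x b z))
          (fun s hs => Finset.mem_erase.2 ⟨fun e => hbS (e ▸ hs), hSB hs⟩)
          (fun hh => hi (Finset.mem_of_mem_erase hh)) (by omega)
          (by
            intro x y hxy
            apply hf
            intro a ha
            by_cases hab : a = b
            · subst hab; simp
            · simp [hab, hxy a (Finset.mem_erase.2 ⟨hab, ha⟩)])
          (by
            intro j hj x y hxy
            apply hh j hj
            intro a ha
            by_cases hab : a = b
            · subst hab; simp
            · rw [update_of_ne hab, update_of_ne hab]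
              apply hxy
              simp only [Finset.mem_insert, Finset.mem_erase] at ha ⊢
              tauto)
          (by
            intro x ⟨hx1, hx2⟩
            have hm : ∀ a ∈ insert i B, a ≠ b → a ∈ insert i (B.erase b) := by
              intro a ha hab
              simp only [Finset.mem_insert, Finset.mem_erase] at ha ⊢
              tauto
            apply hx
            constructor
            · intro a ha
              by_cases hab : a = b
              · subst hab; simp [hz]
              · simp only [update_of_ne hab]
                exact Finset.mem_insert_of_mem (hx1 a (hm a ha hab))
            · intro a ha c hc' e
              by_cases hab : a = b <;> by_cases hcb : c = b
              · rw [hab, hcb]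
              · subst hab
                rw [update_self, update_of_ne hcb, hz] at e
                exact absurd (e ▸ hx1 c (hm c hc' hcb)) hp
              · subst hcb
                rw [update_self, update_of_ne hab, hz] at e
                exact absurd (e ▸ hx1 a (hm a ha hab)) hp
              · rw [update_of_ne hcb, update_of_ne hab] at e
                exact hx2 a (hm a ha hab) c (hm c hc' hcb) e)
        refine ⟨H2, H2d, fun x hg => ?_⟩
        rw [if_neg hbS, zero_add]
        exact H2e x hg
    choose! H Hd He using claim
    refine ⟨fun j x => if ∀ b ∈ B.erase j, π (x b) ≠ p then h j (update x i y0) else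
      ∑ b ∈ B.erase j, if π (x b) = p then H b (x b) j x else 0, ?_, ?_⟩
    · intro j hj x y hxy
      have c1 : (∀ b ∈ B.erase j, π (x b) ≠ p) ↔ (∀ b ∈ B.erase j, π (y b) ≠ p) :=
        forall₂_congr fun b hb => by rw [hxy b hb]
      have c2 : h j (update x i y0) = h j (update y i y0) := by
        apply hh j hj
        intro a ha
        by_cases hai : a = i
        · subst hai; simp
        · rw [update_of_ne hai, update_of_ne hai]
          exact hxy a (Finset.mem_of_mem_insert_of_ne ha hai)
      have c3 : (∑ b ∈ B.erase j, if π (x b) = p then H b (x b) j x else 0) =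
          ∑ b ∈ B.erase j, if π (y b) = p then H b (y b) j y else 0 := by
        apply Finset.sum_congr rfl
        intro b hb
        rw [hxy b hb]
        split_ifs with hbp
        · apply Hd b (y b) (Finset.mem_of_mem_erase hb) hbp j
            (Finset.mem_erase.2 ⟨(Finset.ne_of_mem_erase hb).symm, hj⟩)
          intro a ha
          apply hxy
          simp only [Finset.mem_erase] at ha ⊢
          tauto
        · rfl
      simp only [c1, c2, c3]
    · intro x ⟨hx1, hx2⟩
      by_cases hex : ∃ b ∈ B, π (x b) = p
      · obtain ⟨b, hb, hbp⟩ := hex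
        have huniq : ∀ c ∈ B, π (x c) = p → c = b := fun c hc' e =>
          hx2 c hc' b hb (e.trans hbp.symm)
        have e1 := He b (x b) hb hbp x ⟨fun a ha => by
            have := hx1 a (Finset.mem_of_mem_erase ha)
            rcases Finset.mem_insert.1 this with h1 | h1
            · exact absurd (huniq a (Finset.mem_of_mem_erase ha) h1) (Finset.ne_of_mem_erase ha)
            · exact h1,
          fun a ha c hc' e => hx2 a (Finset.mem_of_mem_erase ha) c (Finset.mem_of_mem_erase hc') e⟩
        rw [update_eq_self] at e1
        rw [e1]
        have e2 : ∀ j ∈ S.erase b, H b (x b) j x =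
          (if ∀ b ∈ B.erase j, π (x b) ≠ p then h j (update x i y0) else
            ∑ b ∈ B.erase j, if π (x b) = p then H b (x b) j x else 0) := by
          intro j hj
          have hbj : b ∈ B.erase j := Finset.mem_erase.2 ⟨(Finset.ne_of_mem_erase hj).symm, hb⟩
          rw [if_neg (fun hall => hall b hbj hbp), Finset.sum_eq_single_of_mem b hbj, if_pos hbp]
          intro c hc' hcb
          rw [if_neg fun e => hcb (huniq c (Finset.mem_of_mem_erase hc') e)]
        rw [Finset.sum_congr rfl e2]
        by_cases hbS : b ∈ S
        · rw [if_pos hbS, ← Finset.add_sum_erase _ _ hbS]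
          congr 1
          refine (if_pos ?_).symm
          intro c hc' e
          exact Finset.ne_of_mem_erase hc' (huniq c (Finset.mem_of_mem_erase hc') e)
        · rw [if_neg hbS, Finset.erase_eq_of_notMem hbS, zero_add]
      · push Not at hex
        have e0 : f x = f (update x i y0) := hf _ _ fun a ha => by rw [update_of_ne (hi' a ha)]
        rw [e0, hx]
        · apply Finset.sum_congr rfl
          intro j hj
          exact (if_pos fun b hb => hex b (Finset.mem_of_mem_erase hb)).symm
        · constructor
          · intro a ha
            by_cases hab : a = i
            · subst hab; simp [hy0]
            · rw [update_of_ne hab]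
              exact hx1 a (Finset.mem_of_mem_insert_of_ne ha hab)
          · intro a ha c hc' e
            by_cases hab : a = i <;> by_cases hcb : c = i
            · rw [hab, hcb]
            · subst hab
              rw [update_self, update_of_ne hcb, hy0] at e
              exact absurd e.symm (hex c (Finset.mem_of_mem_insert_of_ne hc' hcb))
            · subst hcb
              rw [update_self, update_of_ne hab, hy0] at e
              exact absurd e (hex a (Finset.mem_of_mem_insert_of_ne ha hab))
            · rw [update_of_ne hcb, update_of_ne hab] at e
              exact hx2 a (Finset.mem_of_mem_insert_of_ne ha hab) c
                (Finset.mem_of_mem_insert_of_ne hc' hcb) e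

end Charl
namespace Charl

theorem trace_exact {A B C : Type*} [AddCommGroup A] [Module ℂ A] [FiniteDimensional ℂ A]
    [AddCommGroup B] [Module ℂ B] [FiniteDimensional ℂ B]
    [AddCommGroup C] [Module ℂ C] [FiniteDimensional ℂ C]
    (i : A →ₗ[ℂ] B) (q : B →ₗ[ℂ] C) (a : A →ₗ[ℂ] A) (b : B →ₗ[ℂ] B) (c : C →ₗ[ℂ] C)
    (hi : Injective i) (hq : Surjective q) (hx : ∀ y, q y = 0 → ∃ x, i x = y)
    (hqi : ∀ x, q (i x) = 0)
    (ha : ∀ x, b (i x) = i (a x)) (hc : ∀ y, q (b y) = c (q y)) :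
    LinearMap.trace ℂ B b = LinearMap.trace ℂ A a + LinearMap.trace ℂ C c := by
  obtain ⟨s, hs⟩ := q.exists_rightInverse_of_surjective (LinearMap.range_eq_top.2 hq)
  have hs' : ∀ z, q (s z) = z := fun z => LinearMap.congr_fun hs z
  obtain ⟨p0, hp0⟩ := i.exists_leftInverse_of_injective (LinearMap.ker_eq_bot.2 hi)
  have hp0' : ∀ x, p0 (i x) = x := fun z => LinearMap.congr_fun hp0 z
  set p : B →ₗ[ℂ] A := p0 ∘ₗ (LinearMap.id - s ∘ₗ q) with hp
  have hip : ∀ y, i (p y) = y - s (q y) := by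
    intro y
    obtain ⟨x, hx⟩ := hx (y - s (q y)) (by simp [hs'])
    simp only [hp, LinearMap.comp_apply, LinearMap.sub_apply, LinearMap.id_apply]
    rw [← hx, hp0']
  have hpi : p ∘ₗ i = LinearMap.id := by
    ext x; simp [hp, hqi, hp0']
  have e : b = i ∘ₗ (a ∘ₗ p) + (b ∘ₗ s) ∘ₗ q := by
    ext y
    simp only [LinearMap.add_apply, LinearMap.comp_apply]
    rw [← ha, ← map_add, hip]; simp
  have e1 : LinearMap.trace ℂ B (i ∘ₗ (a ∘ₗ p)) = LinearMap.trace ℂ A a := by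
    rw [LinearMap.trace_comp_comm', LinearMap.comp_assoc, hpi, LinearMap.comp_id]
  have e2 : LinearMap.trace ℂ B ((b ∘ₗ s) ∘ₗ q) = LinearMap.trace ℂ C c := by
    rw [LinearMap.trace_comp_comm']
    congr 1
    ext z
    simp [hc, hs']
  conv_lhs => rw [e]
  rw [map_add, e1, e2]

/-- trace of an endomorphism on an invariant subspace -/
noncomputable def tr {M : Type*} [AddCommGroup M] [Module ℂ M] (g : M →ₗ[ℂ] M)
    (U : Submodule ℂ M) (h : ∀ x ∈ U, g x ∈ U) : ℂ :=
  LinearMap.trace ℂ U (g.restrict h)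

theorem tr_sup {M : Type*} [AddCommGroup M] [Module ℂ M] [FiniteDimensional ℂ M]
    (g : M →ₗ[ℂ] M) (U D I J : Submodule ℂ M) (hU : ∀ x ∈ U, g x ∈ U) (hD : ∀ x ∈ D, g x ∈ D)
    (hI : ∀ x ∈ I, g x ∈ I) (hJ : ∀ x ∈ J, g x ∈ J) (eI : I = D ⊓ U) (eJ : J = U ⊔ D) :
    tr g U hU + tr g D hD = tr g I hI + tr g J hJ := by
  subst eI eJ
  unfold tr
  rw [← LinearMap.trace_prodMap']
  have h1 : D ⊓ U ≤ U := inf_le_right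
  have h2 : D ⊓ U ≤ D := inf_le_left
  have h3 : U ≤ U ⊔ D := le_sup_left
  have h4 : D ≤ U ⊔ D := le_sup_right
  refine trace_exact ((Submodule.inclusion h1).prod (-Submodule.inclusion h2))
    ((Submodule.inclusion h3).coprod (Submodule.inclusion h4)) _ _ _ ?_ ?_ ?_ ?_ ?_ ?_
  · intro x y hxy
    have := congrArg (fun z => (z.1 : M)) hxy
    exact Subtype.ext (by simpa using this)
  · rintro ⟨z, hz⟩
    obtain ⟨u, hu, d, hd, rfl⟩ := Submodule.mem_sup.1 hz
    exact ⟨(⟨u, hu⟩, ⟨d, hd⟩), Subtype.ext (by simp)⟩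
  · rintro ⟨⟨u, hu⟩, ⟨d, hd⟩⟩ h
    have h' : u + d = 0 := by simpa using congrArg Subtype.val h
    have hud : d = -u := eq_neg_of_add_eq_zero_right h'
    subst hud
    refine ⟨⟨u, ?_, hu⟩, ?_⟩
    · simpa using hd
    · ext <;> simp
  · rintro ⟨u, hu⟩
    ext; simp
  · rintro ⟨u, hu⟩
    ext <;> simp
  · rintro ⟨⟨u, hu⟩, ⟨d, hd⟩⟩
    ext; simp

theorem tr_quot {M : Type*} [AddCommGroup M] [Module ℂ M] [FiniteDimensional ℂ M]
    (g : M →ₗ[ℂ] M) (U : Submodule ℂ M) (hU : U ≤ U.comap g) :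
    LinearMap.trace ℂ (M ⧸ U) (U.mapQ U g hU) = LinearMap.trace ℂ M g - tr g U hU := by
  rw [eq_sub_iff_add_eq, add_comm]
  symm
  refine trace_exact U.subtype U.mkQ _ _ _ U.injective_subtype U.mkQ_surjective ?_ ?_ ?_ ?_
  · intro y hy
    exact ⟨⟨y, by simpa using hy⟩, rfl⟩
  · intro x; simp
  · intro x; rfl
  · intro x; rfl

theorem tr_range {M N : Type*} [AddCommGroup M] [Module ℂ M] [FiniteDimensional ℂ M]
    [AddCommGroup N] [Module ℂ N] [FiniteDimensional ℂ N]
    (g : M →ₗ[ℂ] M) (U : Submodule ℂ M) (hU : ∀ x ∈ U, g x ∈ U) (f : N →ₗ[ℂ] N)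
    (L : N →ₗ[ℂ] M) (hL : Injective L) (hr : ∀ x, x ∈ U ↔ ∃ y, L y = x)
    (hLf : ∀ y, g (L y) = L (f y)) : tr g U hU = LinearMap.trace ℂ N f := by
  unfold tr
  have := trace_exact (L.codRestrict U fun y => (hr _).2 ⟨y, rfl⟩) (0 : U →ₗ[ℂ] PUnit) f
    (g.restrict hU) 0 ?_ ?_ ?_ ?_ ?_ ?_
  · simpa using this
  · intro x y h; exact hL (congrArg Subtype.val h)
  · intro x; exact ⟨0, rfl⟩
  · rintro ⟨y, hy⟩ -
    obtain ⟨z, rfl⟩ := (hr y).1 hy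
    exact ⟨z, rfl⟩
  · intro x; rfl
  · intro x; exact Subtype.ext (hLf x)
  · intro x; rfl

theorem trace_perm {X : Type*} [Fintype X] [DecidableEq X] (e : X → X)
    (f : (X → ℂ) →ₗ[ℂ] (X → ℂ)) (hf : ∀ F x, f F x = F (e x)) :
    LinearMap.trace ℂ (X → ℂ) f = (Nat.card {x // e x = x} : ℂ) := by
  rw [LinearMap.trace_eq_matrix_trace ℂ (Pi.basisFun ℂ X), Matrix.trace]
  simp [hf, Pi.single_apply, Fintype.card_subtype]

end Charl

namespace Charl

section

variable {ι Pt β : Type*}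

/-- injective tuples -/
abbrev XX (κ : Type*) (π : Pt → β) := {x : κ → Pt // Injective (fun a => π (x a))}

theorem exists_ext [Fintype ι] [DecidableEq ι] [Fintype β] [DecidableEq β] (π : Pt → β)
    (hπ : Surjective π)
    (hc : Fintype.card ι ≤ Fintype.card β) (A : Finset ι) (x : ι → Pt)
    (hx : ∀ a ∈ A, ∀ b ∈ A, π (x a) = π (x b) → a = b) :
    ∃ y : XX ι π, ∀ a ∈ A, y.1 a = x a := by
  have hinj : Set.InjOn (fun a => π (x a)) (A : Set ι) := fun a ha b hb e => hx a ha b hb e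
  obtain ⟨t, ht1, ht2⟩ := Finset.exists_superset_card_eq
    (s := A.image fun a => π (x a)) (n := Fintype.card ι)
    (Finset.card_image_le.trans (Finset.card_le_univ A)) hc
  obtain ⟨g, hg⟩ := Finset.exists_equiv_extend_of_card_eq ht2.symm ht1 hinj
  have hpy : ∀ a, π (if a ∈ A then x a else surjInv hπ (g a)) = g a := by
    intro a
    split_ifs with ha
    · rw [hg a ha]
    · exact surjInv_eq hπ _
  refine ⟨⟨fun a => if a ∈ A then x a else surjInv hπ (g a), ?_⟩, fun a ha => if_pos ha⟩
  intro a b hab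
  simp only [hpy] at hab
  exact g.injective (Subtype.ext hab)

/-- functions depending only on the coordinates in `A` -/
def DD (π : Pt → β) (A : Finset ι) : Submodule ℂ (XX ι π → ℂ) where
  carrier := {F | ∀ x y : XX ι π, (∀ a ∈ A, x.1 a = y.1 a) → F x = F y}
  add_mem' := by
    intro F G hF hG x y h
    simp [hF x y h, hG x y h]
  zero_mem' := by intro x y h; rfl
  smul_mem' := by
    intro c F hF x y h
    simp [hF x y h]

/-- sums of functions that forget one coordinate -/
def UU [DecidableEq ι] (π : Pt → β) (A S : Finset ι) : Submodule ℂ (XX ι π → ℂ) :=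
  ⨆ j ∈ S, DD π (A.erase j)

theorem DD_mono (π : Pt → β) {A B : Finset ι} (h : A ⊆ B) : DD π A ≤ DD π B :=
  fun _ hF x y hxy => hF x y fun a ha => hxy a (h ha)

open Classical in
/-- extension of a function on injective tuples to all tuples -/
noncomputable def extF (π : Pt → β) (A : Finset ι) (F : XX ι π → ℂ) (x : ι → Pt) : ℂ :=
  if h : ∃ y : XX ι π, ∀ a ∈ A, y.1 a = x a then F h.choose else 0

theorem extF_eq (π : Pt → β) (A : Finset ι) (F : XX ι π → ℂ) (hF : F ∈ DD π A) (x : ι → Pt)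
    (y : XX ι π) (hy : ∀ a ∈ A, y.1 a = x a) : extF π A F x = F y := by
  have h : ∃ y : XX ι π, ∀ a ∈ A, y.1 a = x a := ⟨y, hy⟩
  unfold extF
  rw [dif_pos h]
  apply hF
  intro a ha
  rw [h.choose_spec a ha, hy a ha]

theorem extF_dep (π : Pt → β) (A : Finset ι) (F : XX ι π → ℂ) (hF : F ∈ DD π A) :
    Dep A (extF π A F) := by
  intro x x' hxx
  by_cases h : ∃ y : XX ι π, ∀ a ∈ A, y.1 a = x a
  · obtain ⟨y, hy⟩ := h
    rw [extF_eq π A F hF x y hy, extF_eq π A F hF x' y fun a ha => (hy a ha).trans (hxx a ha)]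
  · have h' : ¬ ∃ y : XX ι π, ∀ a ∈ A, y.1 a = x' a := by
      rintro ⟨y, hy⟩
      exact h ⟨y, fun a ha => (hy a ha).trans (hxx a ha).symm⟩
    unfold extF
    rw [dif_neg h, dif_neg h']

theorem inf_eq [Fintype ι] [DecidableEq ι] [Fintype β] [DecidableEq β] (π : Pt → β)
    (hπ : Surjective π) (hc : 2 * Fintype.card ι ≤ Fintype.card β) (B S : Finset ι) (i : ι)
    (hS : S ⊆ B) (hi : i ∉ B) : UU π B S = DD π B ⊓ UU π (insert i B) S := by
  apply le_antisymm
  · refine iSup₂_le fun j hj => le_inf (DD_mono π (Finset.erase_subset _ _)) ?_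
    exact (DD_mono π (Finset.erase_subset_erase _ (Finset.subset_insert _ _))).trans
      (le_iSup₂_of_le (f := fun j (_ : j ∈ S) => DD π ((insert i B).erase j)) j hj le_rfl)
  · rintro F ⟨hF, hU⟩
    have hU' : F ∈ ⨆ j ∈ S, DD π ((insert i B).erase j) := hU
    rw [Submodule.mem_iSup_finset_iff_exists_sum] at hU'
    obtain ⟨μ, hμ⟩ := hU'
    have hcB : B.card + 1 ≤ Fintype.card ι := by
      rw [← Finset.card_insert_of_notMem hi]; exact Finset.card_le_univ _
    have hcS : S.card ≤ B.card := Finset.card_le_card hS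
    have hc' : Fintype.card ι ≤ Fintype.card β := by omega
    have hij : ∀ j ∈ S, (insert i B).erase j = insert i (B.erase j) := by
      intro j hj
      rw [Finset.erase_insert_of_ne]
      rintro rfl
      exact hi (hS hj)
    obtain ⟨h', hd, he⟩ := key π hπ (Finset.univ : Finset β) B S i (extF π B F)
      (fun j => extF π ((insert i B).erase j) (μ j)) hS hi
      (by rw [Finset.card_univ]; omega) (extF_dep π B F hF)
      (by
        intro j hj
        rw [← hij j hj]
        exact extF_dep π _ _ (μ j).2)
      (by
        rintro x ⟨-, hx⟩
        obtain ⟨y, hy⟩ := exists_ext π hπ hc' (insert i B) x hx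
        rw [extF_eq π B F hF x y fun a ha => hy a (Finset.mem_insert_of_mem ha), ← hμ,
          Finset.sum_apply]
        apply Finset.sum_congr rfl
        intro j hj
        rw [extF_eq π _ _ (μ j).2 x y fun a ha => hy a (Finset.mem_of_mem_erase ha)])
    have : F = ∑ j ∈ S, fun y : XX ι π => h' j y.1 := by
      funext y
      rw [Finset.sum_apply, ← he y.1 ⟨fun a _ => Finset.mem_univ _, fun a _ b _ e => y.2 e⟩]
      exact (extF_eq π B F hF y.1 y fun a _ => rfl).symm
    rw [this]
    refine Submodule.sum_mem _ fun j hj => ?_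
    refine Submodule.mem_iSup_of_mem j (Submodule.mem_iSup_of_mem hj ?_)
    exact fun _ _ hxy => hd j hj _ _ hxy

theorem UU_insert [DecidableEq ι] (π : Pt → β) (A B S : Finset ι) (i : ι) (hi : i ∉ B)
    (hA : A = insert i B) : UU π A (insert i S) = UU π A S ⊔ DD π B := by
  unfold UU
  rw [Finset.iSup_insert, sup_comm, hA, Finset.erase_insert hi]

/-- a map of points compatible with the projection -/
def Compat (π : Pt → β) (e : Pt → Pt) : Prop := ∀ p q, π (e p) = π (e q) → π p = π q

/-- action on tuples -/
def actX {κ : Type*} (π : Pt → β) (e : Pt → Pt) (he : Compat π e) (x : XX κ π) : XX κ π :=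
  ⟨fun a => e (x.1 a), fun _ _ h => x.2 (he _ _ h)⟩

/-- action on functions on tuples -/
def opX (κ : Type*) (π : Pt → β) (e : Pt → Pt) (he : Compat π e) :
    (XX κ π → ℂ) →ₗ[ℂ] (XX κ π → ℂ) where
  toFun F x := F (actX π e he x)
  map_add' _ _ := rfl
  map_smul' _ _ := rfl

theorem DD_inv (π : Pt → β) (e : Pt → Pt) (he : Compat π e) (A : Finset ι) :
    ∀ F ∈ DD π A, opX ι π e he F ∈ DD π A :=
  fun _ hF x y hxy => hF _ _ fun a ha => congrArg e (hxy a ha)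

theorem UU_inv [DecidableEq ι] (π : Pt → β) (e : Pt → Pt) (he : Compat π e) (A S : Finset ι) :
    ∀ F ∈ UU π A S, opX ι π e he F ∈ UU π A S := by
  have : UU π A S ≤ (UU π A S).comap (opX ι π e he) := by
    refine iSup₂_le fun j hj F hF => ?_
    exact Submodule.mem_iSup_of_mem j (Submodule.mem_iSup_of_mem hj (DD_inv π e he _ F hF))
  exact this

theorem tr_formula [Fintype ι] [DecidableEq ι] [Fintype Pt] [Fintype β] [DecidableEq β] (π : Pt → β)
    (hπ : Surjective π) (hc : 2 * Fintype.card ι ≤ Fintype.card β)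
    (e : Pt → Pt) (he : Compat π e) (S : Finset ι) : ∀ A, S ⊆ A →
    tr (opX ι π e he) (DD π A) (DD_inv π e he A) - tr (opX ι π e he) (UU π A S) (UU_inv π e he A S)
    = ∑ J ∈ S.powerset, (-1 : ℂ) ^ J.card *
        tr (opX ι π e he) (DD π (A \ J)) (DD_inv π e he (A \ J)) := by
  classical
  have : Finite (XX ι π) := inferInstance
  induction S using Finset.induction_on with
  | empty =>
    intro A _
    have h0 : UU π A ∅ = ⊥ := by simp [UU]
    have : tr (opX ι π e he) (UU π A ∅) (UU_inv π e he A ∅) = 0 := by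
      unfold tr
      have : Subsingleton (UU π A ∅) := by rw [h0]; infer_instance
      rw [show (opX ι π e he).restrict (UU_inv π e he A ∅) = 0 from Subsingleton.elim _ _, map_zero]
    rw [this]; simp
  | insert i S hi ih =>
    intro A hA
    have hiA : i ∈ A := hA (Finset.mem_insert_self _ _)
    have hSA : S ⊆ A := (Finset.subset_insert _ _).trans hA
    have hSB : S ⊆ A.erase i := fun s hs => Finset.mem_erase.2 ⟨fun e => hi (e ▸ hs), hSA hs⟩
    have hAB : A = insert i (A.erase i) := (Finset.insert_erase hiA).symm
    have key := tr_sup (opX ι π e he) (UU π A S) (DD π (A.erase i)) (UU π (A.erase i) S)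
      (UU π A (insert i S)) (UU_inv π e he A S) (DD_inv π e he _) (UU_inv π e he _ _)
      (UU_inv π e he _ _)
      (by
        have := inf_eq π hπ hc (A.erase i) S i hSB (Finset.notMem_erase _ _)
        rwa [← hAB] at this)
      (UU_insert π A (A.erase i) S i (Finset.notMem_erase _ _) hAB)
    rw [Finset.sum_powerset_insert hi, ← ih A hSA]
    have e2 : ∑ t ∈ S.powerset, (-1 : ℂ) ^ (insert i t).card *
        tr (opX ι π e he) (DD π (A \ insert i t)) (DD_inv π e he (A \ insert i t))
        = - ∑ J ∈ S.powerset, (-1 : ℂ) ^ J.card *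
        tr (opX ι π e he) (DD π (A.erase i \ J)) (DD_inv π e he (A.erase i \ J)) := by
      rw [← Finset.sum_neg_distrib]
      apply Finset.sum_congr rfl
      intro t ht
      rw [Finset.card_insert_of_notMem fun h => hi (Finset.mem_powerset.1 ht h)]
      have : A \ insert i t = A.erase i \ t := by
        ext a; simp only [Finset.mem_sdiff, Finset.mem_insert, Finset.mem_erase]; tauto
      simp only [this, pow_succ]
      ring
    rw [e2, ← ih (A.erase i) hSB]
    linear_combination key

theorem tr_DD [Fintype ι] [DecidableEq ι] [Fintype Pt] [Fintype β] [DecidableEq β] (π : Pt → β)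
    (hπ : Surjective π) (hc : Fintype.card ι ≤ Fintype.card β)
    (e : Pt → Pt) (he : Compat π e) (A : Finset ι) :
    tr (opX ι π e he) (DD π A) (DD_inv π e he A) =
      (Nat.card {x : XX A π // actX π e he x = x} : ℂ) := by
  classical
  have : Finite (XX ι π) := inferInstance
  rw [← trace_perm (actX π e he) (opX A π e he) (fun _ _ => rfl)]
  let res : XX ι π → XX A π := fun x => ⟨fun a => x.1 a, fun a b h => Subtype.ext (x.2 h)⟩
  have hres : Surjective res := by
    intro x
    by_cases hA : A.Nonempty
    · obtain ⟨a0, ha0⟩ := hA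
      obtain ⟨y, hy⟩ := exists_ext π hπ hc A
        (fun a => if h : a ∈ A then x.1 ⟨a, h⟩ else x.1 ⟨a0, ha0⟩)
        (by
          intro a ha b hb h
          simp only [dif_pos ha, dif_pos hb] at h
          exact congrArg Subtype.val (x.2 h))
      refine ⟨y, Subtype.ext (funext fun a => ?_)⟩
      have := hy a.1 a.2
      rw [dif_pos a.2] at this
      exact this
    · rw [Finset.not_nonempty_iff_eq_empty] at hA
      subst hA
      by_cases hP : Nonempty Pt
      · obtain ⟨p⟩ := hP
        obtain ⟨y, hy⟩ := exists_ext π hπ hc ∅ (fun _ => p) (by simp)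
        exact ⟨y, Subtype.ext (funext fun a => absurd a.2 (Finset.notMem_empty _))⟩
      · have hβ : IsEmpty β := ⟨fun b => hP ⟨(hπ b).choose⟩⟩
        have hι : IsEmpty ι := by
          rw [← Fintype.card_eq_zero_iff] at hβ ⊢
          omega
        exact ⟨⟨fun a => isEmptyElim a, fun a => isEmptyElim a⟩,
          Subtype.ext (funext fun a => isEmptyElim a.1)⟩
  refine tr_range _ _ _ _ (LinearMap.funLeft ℂ ℂ res)
    (LinearMap.funLeft_injective_of_surjective ℂ ℂ res hres) ?_ ?_
  · intro F
    constructor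
    · intro hF
      refine ⟨fun x => F (surjInv hres x), ?_⟩
      funext x
      apply hF
      intro a ha
      have := surjInv_eq hres (res x)
      exact congrFun (congrArg Subtype.val this) ⟨a, ha⟩
    · rintro ⟨G, rfl⟩ x y hxy
      have : res x = res y := Subtype.ext (funext fun a => hxy a.1 a.2)
      simp [LinearMap.funLeft_apply, this]
  · intro F
    rfl

end

end Charl

namespace Charl

section

theorem wAct_mul {G : Type*} [CommGroup G] {n : ℕ} (w v : Wr G n) (p : G × Fin n) :
    wAct (w * v) p = wAct w (wAct v p) := by
  have h : (permMulAut G n w.right) v.left (w.right (v.right p.2)) = v.left (v.right p.2) := by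
    change v.left (w.right.symm (w.right (v.right p.2))) = _
    rw [Equiv.symm_apply_apply]
  simp only [wAct, SemidirectProduct.mul_left, SemidirectProduct.mul_right, Pi.mul_apply,
    Equiv.Perm.mul_apply, h, Prod.mk.injEq, and_true]
  rw [mul_assoc, mul_comm (w.left _)]

theorem wAct_one {G : Type*} [CommGroup G] {n : ℕ} (p : G × Fin n) :
    wAct (1 : Wr G n) p = p := by
  simp [wAct]

theorem wAct_compat {G : Type*} [CommGroup G] {n : ℕ} (w : Wr G n) :
    Compat (Prod.snd : G × Fin n → Fin n) (wAct w) := by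
  intro p q h
  exact w.right.injective h

theorem wAct_inv_fix {G : Type*} [CommGroup G] {n : ℕ} (w : Wr G n) (p : G × Fin n) :
    wAct w⁻¹ p = p ↔ wAct w p = p := by
  constructor
  · intro h
    conv_lhs => rw [← h, ← wAct_mul, mul_inv_cancel, wAct_one]
  · intro h
    conv_lhs => rw [← h, ← wAct_mul, inv_mul_cancel, wAct_one]

theorem wAct_fix {G : Type*} [CommGroup G] {n : ℕ} (w : Wr G n) (p : G × Fin n) :
    wAct w p = p ↔ (w.right p.2 = p.2 ∧ w.left p.2 = 1) := by
  obtain ⟨g, i⟩ := p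
  simp only [wAct, Prod.mk.injEq]
  constructor
  · rintro ⟨h1, h2⟩
    rw [h2] at h1
    exact ⟨h2, by simpa using h1⟩
  · rintro ⟨h1, h2⟩
    rw [h1, h2]; simp

/-- fixed base points -/
abbrev Fx {G : Type*} [CommGroup G] {n : ℕ} (w : Wr G n) :=
  {i : Fin n // w.right i = i ∧ w.left i = 1}

theorem theta_eq {r n : ℕ} (hr : 1 ≤ r) (w : Wr (Multiplicative (ZMod r)) n) :
    theta w = Nat.card (Fx w) := by
  have : NeZero r := ⟨by omega⟩
  let e : {p : Multiplicative (ZMod r) × Fin n // wAct w p = p} ≃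
      Multiplicative (ZMod r) × Fx w :=
    { toFun := fun p => (p.1.1, ⟨p.1.2, (wAct_fix w p.1).1 p.2⟩)
      invFun := fun q => ⟨(q.1, q.2.1), (wAct_fix w _).2 q.2.2⟩
      left_inv := fun p => rfl
      right_inv := fun q => rfl }
  have hG : Nat.card (Multiplicative (ZMod r)) = r := by
    rw [Nat.card_congr Multiplicative.toAdd, Nat.card_zmod]
  rw [theta, Nat.card_congr e, Nat.card_prod, hG]
  exact Nat.mul_div_cancel_left _ hr

theorem card_fix {r n : ℕ} (hr : 1 ≤ r) (w : Wr (Multiplicative (ZMod r)) n)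
    (κ : Type) [Fintype κ] :
    Nat.card {x : XX κ (Prod.snd : Multiplicative (ZMod r) × Fin n → Fin n) //
      actX Prod.snd (wAct w⁻¹) (wAct_compat w⁻¹) x = x}
    = r ^ Fintype.card κ * (theta w).descFactorial (Fintype.card κ) := by
  classical
  have : NeZero r := ⟨by omega⟩
  let e : {x : XX κ (Prod.snd : Multiplicative (ZMod r) × Fin n → Fin n) //
      actX Prod.snd (wAct w⁻¹) (wAct_compat w⁻¹) x = x} ≃
      (κ → Multiplicative (ZMod r)) × (κ ↪ Fx w) :=
    { toFun := fun x => (fun a => (x.1.1 a).1,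
        ⟨fun a => ⟨(x.1.1 a).2, (wAct_fix w _).1 ((wAct_inv_fix w _).1
          (congrFun (congrArg Subtype.val x.2) a))⟩,
          fun a b h => x.1.2 (congrArg Subtype.val h)⟩)
      invFun := fun q => ⟨⟨fun a => (q.1 a, (q.2 a).1),
          fun a b h => q.2.injective (Subtype.ext h)⟩,
        Subtype.ext (funext fun a => (wAct_inv_fix w _).2 ((wAct_fix w _).2 (q.2 a).2))⟩
      left_inv := fun p => rfl
      right_inv := fun q => rfl }
  have hG : Fintype.card (Multiplicative (ZMod r)) = r := by
    rw [Fintype.card_multiplicative, ZMod.card]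
  rw [theta_eq hr, Nat.card_congr e, Nat.card_prod, Nat.card_eq_fintype_card,
    Nat.card_eq_fintype_card, Nat.card_eq_fintype_card, Fintype.card_embedding_eq,
    Fintype.card_fun, hG]

/-- the representation on functions on tuples -/
def rep (G : Type*) [CommGroup G] (n : ℕ) (κ : Type*) :
    Representation ℂ (Wr G n) (XX κ (Prod.snd : G × Fin n → Fin n) → ℂ) where
  toFun w := opX κ Prod.snd (wAct w⁻¹) (wAct_compat w⁻¹)
  map_one' := by
    ext F x : 2
    change F _ = F x
    congr 1
    apply Subtype.ext
    funext a
    change wAct (1 : Wr G n)⁻¹ (x.1 a) = x.1 a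
    rw [inv_one, wAct_one]
  map_mul' w v := by
    ext F x : 2
    change F _ = F _
    congr 1
    apply Subtype.ext
    funext a
    change wAct (w * v)⁻¹ (x.1 a) = wAct v⁻¹ (wAct w⁻¹ (x.1 a))
    rw [mul_inv_rev, wAct_mul]

end

end Charl

/-- **Charlier class functions are characters.**
Let `r, n ≥ 1` and `0 ≤ k ≤ n/2`.  Then the class function `g ↦ C_k^{(1/r)}(θ(g))` on
`C_r ≀ Sₙ` is a character: there is a finite-dimensional complex representation of
`C_r ≀ Sₙ` whose character equals this function. -/
theorem charlier_is_character (r n k : ℕ) (hr : 1 ≤ r) (hn : 1 ≤ n) (hk : 2 * k ≤ n) :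
    ∃ V : FDRep ℂ (Wr (Multiplicative (ZMod r)) n),
      ∀ w : Wr (Multiplicative (ZMod r)) n,
        V.character w = ((charlier (1 / r) k (theta w) : ℝ) : ℂ) := by
  classical
  have : NeZero r := ⟨by omega⟩
  let G := Multiplicative (ZMod r)
  let π : G × Fin n → Fin n := Prod.snd
  have hπ : Function.Surjective π := Prod.snd_surjective
  have hc : 2 * Fintype.card (Fin k) ≤ Fintype.card (Fin n) := by simpa using hk
  have hc' : Fintype.card (Fin k) ≤ Fintype.card (Fin n) := by omega
  let ρ := Charl.rep G n (Fin k)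
  let U := Charl.UU (ι := Fin k) π Finset.univ Finset.univ
  have hU : ∀ w, U ≤ U.comap (ρ w) := fun w =>
    Charl.UU_inv π (wAct w⁻¹) (Charl.wAct_compat w⁻¹) Finset.univ Finset.univ
  have : Finite (Charl.XX (Fin k) π) := inferInstance
  refine ⟨FDRep.of (ρ.quotient U hU), fun w => ?_⟩
  have h1 : (FDRep.of (ρ.quotient U hU)).character w =
      LinearMap.trace ℂ _ (U.mapQ U (ρ w) (hU w)) := rfl
  rw [h1, Charl.tr_quot]
  have htop : LinearMap.trace ℂ _ (ρ w) = Charl.tr (ρ w) (Charl.DD π Finset.univ)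
      (Charl.DD_inv π (wAct w⁻¹) (Charl.wAct_compat w⁻¹) _) := by
    symm
    refine Charl.tr_range _ _ _ _ LinearMap.id Function.injective_id ?_ ?_
    · intro F
      refine ⟨fun _ => ⟨F, rfl⟩, fun _ x y hxy => ?_⟩
      have hxy' : x = y := Subtype.ext (funext fun a => hxy a (Finset.mem_univ a))
      rw [hxy']
    · intro F; rfl
  rw [htop]
  have h2 := Charl.tr_formula π hπ hc (wAct w⁻¹) (Charl.wAct_compat w⁻¹)
    (Finset.univ : Finset (Fin k)) Finset.univ (Finset.Subset.refl _)
  refine h2.trans ?_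
  have h3 : ∀ J ∈ (Finset.univ : Finset (Fin k)).powerset, (-1 : ℂ) ^ J.card *
      Charl.tr (Charl.opX (Fin k) π (wAct w⁻¹) (Charl.wAct_compat w⁻¹))
        (Charl.DD π (Finset.univ \ J)) (Charl.DD_inv π _ (Charl.wAct_compat w⁻¹) _)
      = (fun m : ℕ => (-1 : ℂ) ^ m * (r ^ (k - m) * (theta w).descFactorial (k - m) : ℕ))
        J.card := by
    intro J _
    rw [Charl.tr_DD π hπ hc', Charl.card_fix hr w]
    have : Fintype.card ↥(Finset.univ \ J) = k - J.card := by
      rw [Fintype.card_coe, ← Finset.compl_eq_univ_sdiff, Finset.card_compl, Fintype.card_fin]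
    rw [this]
  have h4 := Finset.sum_powerset_apply_card
    (fun m : ℕ => (-1 : ℂ) ^ m * (r ^ (k - m) * (theta w).descFactorial (k - m) : ℕ))
    (x := (Finset.univ : Finset (Fin k)))
  rw [Finset.card_univ, Fintype.card_fin, ← Finset.sum_range_reflect] at h4
  refine ((Finset.sum_congr rfl h3).trans h4).trans ?_
  rw [charlier]
  push_cast
  apply Finset.sum_congr rfl
  intro j hj
  have hj' : j ≤ k := Nat.lt_succ_iff.1 (Finset.mem_range.1 hj)
  have e2 : k - (k - j) = j := by omega
  have e3 : (((theta w).descFactorial j : ℕ) : ℂ) = ∏ m ∈ Finset.range j, ((theta w : ℂ) - m) := by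
    rw [← descPochhammer_eval_eq_descFactorial, descPochhammer_eval_eq_prod_range]
  rw [e2, e3, Nat.choose_symm hj', nsmul_eq_mul]
  simp
  ring
end

section
/- Let r ≥ 1, n ≥ 1 and 1 ≤ t ≤ n be integers, and suppose Y is a nonempty subset of C_r ≀ S_n that is both a t-design and an (n−t)-code. Then the distance distribution (A_0,…,A_n) of Y satisfies, for each i ∈ {0,1,…,n−1}, A_{n−i} = Σ_{j=i}^{t} (−1)^{j−i} · binom(j,i) · binom(n,j) · ( |Y| / (r^j · n!/(n−j)!) − 1 ). -/
section Helpers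

open Classical in
/-- `Y` is a design on `j`-tuples with constant `c`. -/
def DesC {G : Type*} [CommGroup G] {n : ℕ} (Y : Finset (Wr G n)) (j c : ℕ) : Prop :=
  ∀ a b : Fin j → G × Fin n, (Function.Injective fun s => (a s).2) →
    (Function.Injective fun s => (b s).2) →
    (Y.filter fun y => (fun s => wAct y (a s)) = b).card = c

theorem wAct_snd {G : Type*} [CommGroup G] {n : ℕ} (w : Wr G n) (p : G × Fin n) :
    (wAct w p).2 = w.right p.2 := rfl

theorem wAct_mul {G : Type*} [CommGroup G] {n : ℕ} (x y : Wr G n) (p : G × Fin n) :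
    wAct (x * y) p = wAct x (wAct y p) := by
  refine Prod.ext ?_ rfl
  simp [wAct, permMulAut, MulEquiv.arrowCongr]
  rw [mul_comm (x.left _), mul_assoc]

theorem wAct_one {G : Type*} [CommGroup G] {n : ℕ} (p : G × Fin n) :
    wAct (1 : Wr G n) p = p := by
  simp [wAct]

open Classical in
/-- The set of fixed points. -/
noncomputable def fixSet {G : Type*} [CommGroup G] {n : ℕ} (w : Wr G n) : Finset (Fin n) :=
  Finset.univ.filter fun i => w.right i = i ∧ w.left i = 1

theorem wAct_eq_self {G : Type*} [CommGroup G] {n : ℕ} (w : Wr G n) (p : G × Fin n) :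
    wAct w p = p ↔ p.2 ∈ fixSet w := by
  simp only [fixSet, Finset.mem_filter, Finset.mem_univ, true_and, wAct, Prod.ext_iff]
  constructor
  · rintro ⟨h1, h2⟩
    rw [h2] at h1
    exact ⟨h2, by simpa using h1⟩
  · rintro ⟨h1, h2⟩
    rw [h1]
    simp [h2]

theorem mem_fixSet_iff {G : Type*} [CommGroup G] {n : ℕ} (x y : Wr G n) (i : Fin n) :
    i ∈ fixSet (x⁻¹ * y) ↔ wAct y (1, i) = wAct x (1, i) := by
  rw [← wAct_eq_self (x⁻¹ * y) ((1 : G), i), wAct_mul]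
  constructor
  · intro h
    have := congrArg (wAct x) h
    rwa [← wAct_mul, mul_inv_cancel, wAct_one] at this
  · intro h
    rw [h, ← wAct_mul, inv_mul_cancel, wAct_one]

theorem theta_eq {r n : ℕ} (hr : 1 ≤ r) (w : Wr (Multiplicative (ZMod r)) n) :
    theta w = (fixSet w).card := by
  have : NeZero r := ⟨by omega⟩
  unfold theta
  have e : {p : Multiplicative (ZMod r) × Fin n // wAct w p = p} ≃
      Multiplicative (ZMod r) × {i // i ∈ fixSet w} :=
    { toFun := fun p => (p.1.1, ⟨p.1.2, (wAct_eq_self w p.1).1 p.2⟩)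
      invFun := fun q => ⟨(q.1, q.2.1), (wAct_eq_self w _).2 q.2.2⟩
      left_inv := fun _ => rfl
      right_inv := fun _ => rfl }
  rw [Nat.card_congr e, Nat.card_prod]
  have h1 : Nat.card (Multiplicative (ZMod r)) = r := by
    rw [Nat.card_congr Multiplicative.toAdd, Nat.card_zmod]
  rw [h1, Nat.mul_div_cancel_left _ (by omega)]
  simp

theorem fixSet_full {G : Type*} [CommGroup G] {n : ℕ} (w : Wr G n)
    (h : (fixSet w).card = n) : w = 1 := by
  have h2 : fixSet w = Finset.univ := by
    apply Finset.eq_univ_of_card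
    simpa using h
  have h3 : ∀ i, w.right i = i ∧ w.left i = 1 := by
    intro i
    have : i ∈ fixSet w := by rw [h2]; simp
    simpa [fixSet] using this
  apply SemidirectProduct.ext
  · funext i
    simpa using (h3 i).2
  · apply Equiv.ext
    intro i
    simpa using (h3 i).1

theorem fixSet_one {G : Type*} [CommGroup G] {n : ℕ} :
    (fixSet (1 : Wr G n)).card = n := by
  simp [fixSet]

theorem fixSet_le {G : Type*} [CommGroup G] {n : ℕ} (w : Wr G n) :
    (fixSet w).card ≤ n := by
  simpa using Finset.card_le_univ (fixSet w)

theorem snoc_inj {G : Type*} {n j : ℕ} (b : Fin j → G × Fin n) (β : G × Fin n)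
    (hb : Function.Injective fun s => (b s).2) (hβ : ∀ s, (b s).2 ≠ β.2) :
    Function.Injective fun s => ((Fin.snoc b β : Fin (j+1) → G × Fin n) s).2 := by
  intro s
  refine Fin.lastCases ?_ (fun s => ?_) s
  · intro u
    refine Fin.lastCases ?_ (fun u => ?_) u
    · simp
    · intro h
      simp at h
      exact absurd h.symm (hβ u)
  · intro u
    refine Fin.lastCases ?_ (fun u => ?_) u
    · intro h
      simp at h
      exact absurd h (hβ s)
    · intro h
      simp only [Fin.snoc_castSucc] at h
      rw [hb h]

theorem desC_down {G : Type*} [CommGroup G] [Fintype G] {n : ℕ} (Y : Finset (Wr G n)) (j c : ℕ)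
    (hj : j + 1 ≤ n) (h : DesC Y (j+1) c) : DesC Y j (c * (Fintype.card G * (n - j))) := by
  classical
  intro a b ha hb
  have hcard : ∀ b : Fin j → G × Fin n, (Function.Injective fun s => (b s).2) →
      (Finset.univ \ Finset.univ.image (fun s => (b s).2)).card = n - j := by
    intro b hb
    rw [Finset.card_sdiff_of_subset (Finset.subset_univ _), Finset.card_image_of_injective _ hb]
    simp
  obtain ⟨i0, hi0⟩ : (Finset.univ \ Finset.univ.image (fun s => (a s).2)).Nonempty := by
    rw [← Finset.card_pos, hcard a ha]; omega
  have hi0' : ∀ s, (a s).2 ≠ i0 := by simpa using hi0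
  set T : Finset (G × Fin n) :=
    Finset.univ ×ˢ (Finset.univ \ Finset.univ.image (fun s => (b s).2)) with hT
  have hTc : T.card = Fintype.card G * (n - j) := by
    rw [hT, Finset.card_product, hcard b hb]; simp
  rw [Finset.card_eq_sum_card_fiberwise (f := fun y => wAct y ((1 : G), i0)) (t := T)]
  · rw [Finset.sum_congr rfl (g := fun _ => c)]
    · rw [Finset.sum_const, hTc, smul_eq_mul, mul_comm]
    · intro β hβ
      have hβ' : ∀ s, (b s).2 ≠ β.2 := by simpa [hT] using hβ
      rw [← h (Fin.snoc a ((1 : G), i0)) (Fin.snoc b β) (snoc_inj a _ ha hi0')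
        (snoc_inj b β hb hβ'), Finset.filter_filter]
      congr 1
      apply Finset.filter_congr
      intro y _
      constructor
      · rintro ⟨h1, h2⟩
        funext s
        refine Fin.lastCases ?_ (fun s => ?_) s
        · simpa using h2
        · simpa using congrFun h1 s
      · intro h1
        constructor
        · funext s
          simpa using congrFun h1 s.castSucc
        · simpa using congrFun h1 (Fin.last j)
  · intro y hy
    have hy2 := (Finset.mem_filter.1 (Finset.mem_coe.1 hy)).2
    simp only [hT, Finset.coe_product, Set.mem_prod, Finset.coe_univ, Set.mem_univ, true_and,
      Finset.mem_coe, Finset.mem_sdiff, Finset.mem_univ, Finset.mem_image, not_exists]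
    intro s hs
    rw [← hy2] at hs
    exact hi0' s (y.right.injective hs)

theorem desC_card {G : Type*} [CommGroup G] [Fintype G] {n : ℕ} (Y : Finset (Wr G n)) (j : ℕ) :
    ∀ c, j ≤ n → DesC Y j c → Y.card = c * (Fintype.card G ^ j * n.descFactorial j) := by
  induction j with
  | zero =>
    intro c _ h
    have := h Fin.elim0 Fin.elim0 (fun s => s.elim0) (fun s => s.elim0)
    rw [Finset.filter_true_of_mem] at this
    · simpa using this
    · intro y _
      funext s
      exact s.elim0
  | succ j ih =>
    intro c hj h
    rw [ih _ (by omega) (desC_down Y j c hj h), Nat.descFactorial_succ]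
    ring

theorem desC_le {G : Type*} [CommGroup G] [Fintype G] {n : ℕ} (Y : Finset (Wr G n)) (j t c : ℕ)
    (hjt : j ≤ t) (ht : t ≤ n) (h : DesC Y t c) : ∃ c', DesC Y j c' := by
  induction t, hjt using Nat.le_induction generalizing c with
  | base => exact ⟨c, h⟩
  | succ k hk ih => exact ih _ (by omega) (desC_down Y k c ht h)

theorem desC_moment {G : Type*} [CommGroup G] [Fintype G] {n : ℕ} (Y : Finset (Wr G n)) (j c : ℕ)
    (h : DesC Y j c) :
    ∑ x ∈ Y, ∑ y ∈ Y, ((fixSet (x⁻¹ * y)).card.choose j) = n.choose j * (Y.card * c) := by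
  classical
  have h1 : ∀ w : Wr G n, (fixSet w).card.choose j =
      ∑ S ∈ Finset.powersetCard j (Finset.univ : Finset (Fin n)),
        if S ⊆ fixSet w then 1 else 0 := by
    intro w
    rw [← Finset.card_powersetCard, ← Finset.card_filter]
    congr 1
    ext S
    simp [Finset.mem_powersetCard, and_comm]
  have h2 : ∀ x ∈ Y, ∑ y ∈ Y, ((fixSet (x⁻¹ * y)).card.choose j) = n.choose j * c := by
    intro x _
    simp_rw [h1]
    rw [Finset.sum_comm, Finset.sum_congr rfl (g := fun _ => c)]
    · simp [Finset.card_powersetCard]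
    · intro S hS
      have hc : S.card = j := (Finset.mem_powersetCard.1 hS).2
      rw [← Finset.card_filter]
      have hinj : Function.Injective (S.orderEmbOfFin hc) := (S.orderEmbOfFin hc).injective
      rw [← h (fun s => (1, S.orderEmbOfFin hc s)) (fun s => wAct x (1, S.orderEmbOfFin hc s))
        hinj (fun s u hsu => hinj (x.right.injective hsu))]
      congr 1
      apply Finset.filter_congr
      intro y _
      constructor
      · intro hs
        funext s
        exact (mem_fixSet_iff x y _).1 (hs (S.orderEmbOfFin_mem hc s))
      · intro hs i hi
        have : i ∈ Set.range (S.orderEmbOfFin hc) := by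
          rw [Finset.range_orderEmbOfFin]; exact hi
        obtain ⟨s, rfl⟩ := this
        exact (mem_fixSet_iff x y _).2 (congrFun hs s)
  rw [Finset.sum_congr rfl h2, Finset.sum_const, smul_eq_mul]
  ring

theorem choose_inv (i t k : ℕ) (hk : k ≤ t) :
    ∑ j ∈ Finset.Icc i t, (-1 : ℝ) ^ (j - i) * (j.choose i : ℝ) * (k.choose j : ℝ)
      = if k = i then 1 else 0 := by
  by_cases hik : i ≤ k
  · have h1 : ∑ j ∈ Finset.Icc i t, (-1 : ℝ) ^ (j - i) * (j.choose i : ℝ) * (k.choose j : ℝ)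
        = ∑ j ∈ Finset.Icc i k, (-1 : ℝ) ^ (j - i) * (j.choose i : ℝ) * (k.choose j : ℝ) := by
      symm
      apply Finset.sum_subset (Finset.Icc_subset_Icc_right hk)
      intro j hj hj2
      rw [Finset.mem_Icc] at hj hj2
      rw [Nat.choose_eq_zero_of_lt (by omega : k < j)]
      simp
    rw [h1]
    have h2 : Finset.Icc i k = (Finset.range (k - i + 1)).image (fun m => i + m) := by
      ext j
      simp only [Finset.mem_Icc, Finset.mem_image, Finset.mem_range]
      constructor
      · intro h; exact ⟨j - i, by omega, by omega⟩
      · rintro ⟨m, hm, rfl⟩; omega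
    rw [h2, Finset.sum_image (by intro a _ b _ h; simpa using h)]
    have h3 : ∀ m ∈ Finset.range (k - i + 1),
        (-1 : ℝ) ^ (i + m - i) * ((i + m).choose i : ℝ) * (k.choose (i + m) : ℝ)
          = (k.choose i : ℝ) * (((-1 : ℤ) ^ m * ((k - i).choose m : ℤ) : ℤ) : ℝ) := by
      intro m hm
      rw [Finset.mem_range] at hm
      have := Nat.choose_mul (n := k) (k := i + m) (s := i) (by omega)
      rw [Nat.add_sub_cancel_left] at this ⊢
      have h' : (k.choose (i+m) : ℝ) * ((i+m).choose i : ℝ) =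
        (k.choose i : ℝ) * ((k-i).choose m : ℝ) := by exact_mod_cast this
      push_cast
      linear_combination (-1 : ℝ)^m * h'
    rw [Finset.sum_congr rfl h3, ← Finset.mul_sum, ← Int.cast_sum,
      Int.alternating_sum_range_choose]
    by_cases hki : k = i
    · subst hki; simp
    · have : k - i ≠ 0 := by omega
      simp [hki, this]
  · rw [if_neg (by omega)]
    apply Finset.sum_eq_zero
    intro j hj
    rw [Finset.mem_Icc] at hj
    rw [Nat.choose_eq_zero_of_lt (by omega : k < j)]
    simp

end Helpers

/-- **The distance distribution of a `t`-design that is an `(n-t)`-code is determined.**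
Let `r, n ≥ 1`, `1 ≤ t ≤ n`, and suppose the nonempty subset `Y` of `C_r ≀ Sₙ` is both
a `t`-design and an `(n-t)`-code.  Then the distance distribution
`A_i = (1/|Y|)·#{(x,y) ∈ Y² : n - θ(x⁻¹y) = i}` of `Y` satisfies, for `0 ≤ i ≤ n-1`,
`A_{n-i} = ∑_{j=i}^t (-1)^{j-i} binom(j,i) binom(n,j) (|Y|/(r^j (n)_j) - 1)`. -/
theorem distance_distribution_determined (r n t : ℕ) (hr : 1 ≤ r) (hn : 1 ≤ n)
    (ht1 : 1 ≤ t) (htn : t ≤ n)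
    (Y : Finset (Wr (Multiplicative (ZMod r)) n)) (hY : Y.Nonempty)
    (hdesign : IsTDesign r n t ↑Y) (hcode : IsDCode r n (n - t) ↑Y)
    (A : ℕ → ℝ)
    (hA : ∀ i, A i = (1 / (Y.card : ℝ)) *
      (Nat.card {p : Wr (Multiplicative (ZMod r)) n × Wr (Multiplicative (ZMod r)) n //
        p.1 ∈ Y ∧ p.2 ∈ Y ∧ n - theta (p.1⁻¹ * p.2) = i} : ℝ))
    (i : ℕ) (hi : i < n) :
    A (n - i) = ∑ j ∈ Finset.Icc i t,
      (-1 : ℝ) ^ (j - i) * (j.choose i : ℝ) * (n.choose j : ℝ) *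
        ((Y.card : ℝ) / ((r : ℝ) ^ j * (n.descFactorial j : ℝ)) - 1) := by
  classical
  have : NeZero r := ⟨by omega⟩
  have hG : Fintype.card (Multiplicative (ZMod r)) = r := by
    rw [Fintype.card_multiplicative, ZMod.card]
  obtain ⟨c, _, hc⟩ := hdesign
  have hD : DesC Y t c := by
    intro a b ha hb
    rw [← hc a ha b hb, ← Nat.card_eq_finsetCard]
    apply Nat.card_congr
    apply Equiv.subtypeEquivRight
    intro y
    simp
  have hYpos : (0 : ℝ) < Y.card := by exact_mod_cast hY.card_pos
  -- second moments
  have hmom : ∀ j ∈ Finset.Icc i t,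
      ∑ x ∈ Y, ∑ y ∈ Y, (((fixSet (x⁻¹ * y)).card.choose j : ℕ) : ℝ) =
        (n.choose j : ℝ) * (Y.card * (Y.card / ((r : ℝ) ^ j * (n.descFactorial j : ℝ)))) := by
    intro j hj
    rw [Finset.mem_Icc] at hj
    obtain ⟨c', hc'⟩ := desC_le Y j t c hj.2 htn hD
    have h1 := desC_moment Y j c' hc'
    have h2 := desC_card Y j c' (by omega) hc'
    rw [hG] at h2
    have hpos : (0 : ℝ) < (r : ℝ) ^ j * (n.descFactorial j : ℝ) := by
      have : 0 < n.descFactorial j := Nat.descFactorial_pos.2 (by omega)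
      positivity
    have h3 : (Y.card : ℝ) / ((r : ℝ) ^ j * (n.descFactorial j : ℝ)) = c' := by
      rw [div_eq_iff hpos.ne']
      exact_mod_cast h2
    rw [h3]
    exact_mod_cast h1
  -- pairwise identity
  have hpair : ∀ x ∈ Y, ∀ y ∈ Y,
      (if n - theta (x⁻¹ * y) = n - i then (1 : ℝ) else 0) =
        ∑ j ∈ Finset.Icc i t, ((-1 : ℝ) ^ (j - i) * (j.choose i : ℝ)) *
          ((((fixSet (x⁻¹ * y)).card.choose j : ℕ) : ℝ) -
            if x = y then (n.choose j : ℝ) else 0) := by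
    intro x hx y hy
    have hle := fixSet_le (x⁻¹ * y)
    by_cases hxy : x = y
    · subst hxy
      rw [theta_eq hr, inv_mul_cancel, fixSet_one, if_neg (by omega)]
      simp
    · have h1 := hcode x hx y hy hxy
      have h2 : theta (x⁻¹ * y) ≤ t := by omega
      rw [theta_eq hr] at h2 ⊢
      simp only [if_neg hxy, sub_zero]
      rw [choose_inv i t _ h2]
      congr 1
      apply propext
      omega
  have hcount : (Nat.card {p : Wr (Multiplicative (ZMod r)) n × Wr (Multiplicative (ZMod r)) n //
        p.1 ∈ Y ∧ p.2 ∈ Y ∧ n - theta (p.1⁻¹ * p.2) = n - i} : ℝ) =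
      ∑ x ∈ Y, ∑ y ∈ Y, (if n - theta (x⁻¹ * y) = n - i then (1 : ℝ) else 0) := by
    rw [← Finset.sum_product' (f := fun x y => if n - theta (x⁻¹ * y) = n - i then (1 : ℝ) else 0),
      Finset.sum_boole]
    congr 1
    rw [← Nat.card_eq_finsetCard]
    apply Nat.card_congr
    apply Equiv.subtypeEquivRight
    intro p
    simp [and_assoc]
  rw [hA, hcount, Finset.sum_congr rfl (fun x hx => Finset.sum_congr rfl (hpair x hx))]
  simp_rw [Finset.sum_comm (s := Y) (t := Finset.Icc i t), ← Finset.mul_sum]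
  rw [Finset.mul_sum]
  apply Finset.sum_congr rfl
  intro j hj
  simp_rw [Finset.sum_sub_distrib]
  rw [hmom j hj]
  have hdiag : ∑ x ∈ Y, ∑ y ∈ Y, (if x = y then (n.choose j : ℝ) else 0) =
      Y.card * (n.choose j : ℝ) := by
    rw [Finset.sum_congr rfl (g := fun _ => (n.choose j : ℝ))]
    · simp
    · intro x hx
      simp [hx]
  rw [hdiag]
  field_simp
end
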